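/- arXiv:1407.2861 — 3 statements merged into one kernel-verified Lean document; each statement's English description precedes it below -/
import Mathlib

section
/- Fix an integer n ≥ 2. There is a constant C = C(n) > 0 such that for every interval I ⊆ ℝ and every Q ≥ 2, the number Ω_n(Q,I) of algebraic integers of degree n and height at most Q lying in I satisfies |Ω_n(Q,I) − Q^n ∫_I ω_n(Q^{−1},t) dt| ≤ C · Q^{n−1} (ln Q)^{δ(n)}, where δ(n)=1 if n≤2 and δ(n)=0 if n≥3. -/
open MeasureTheory Filter

/-- The domain `D_n(ξ,t) ⊆ ℝ^{n-1}`: vectors `(p_1, …, p_{n-1})` (indexed by `i : Fin (n-1)`,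
where `p i` stands for `p_{i+1}`) with `|p_i| ≤ 1` and `|ξ t^n + ∑_{k=1}^{n-1} p_k t^k| ≤ 1`. -/
def Dset (n : ℕ) (ξ t : ℝ) : Set (Fin (n - 1) → ℝ) :=
  {p | (∀ i, |p i| ≤ 1) ∧ |ξ * t ^ n + ∑ i, p i * t ^ ((i : ℕ) + 1)| ≤ 1}

/-- The density function `ω_n(ξ,t)`. -/
noncomputable def omegaFn (n : ℕ) (ξ t : ℝ) : ℝ :=
  ∫ p in Dset n ξ t,
    |(n : ℝ) * ξ * t ^ (n - 1) + ∑ i : Fin (n - 1), ((i : ℕ) + 1 : ℝ) * p i * t ^ (i : ℕ)|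

/-- `p` is the minimal polynomial of the real number `α`: a nonzero integer polynomial of
minimal degree, with coprime coefficients and positive leading coefficient, vanishing at `α`. -/
def IsMinIntPoly (α : ℝ) (p : Polynomial ℤ) : Prop :=
  p ≠ 0 ∧ Polynomial.aeval α p = 0 ∧ 0 < p.leadingCoeff ∧ p.content = 1 ∧
    ∀ q : Polynomial ℤ, q ≠ 0 → Polynomial.aeval α q = 0 → p.natDegree ≤ q.natDegree

/-- `Ω_n(Q,S)`: the number of algebraic integers `α ∈ S` of degree `n` and height at most `Q`,
i.e. whose minimal polynomial is monic, of degree `n`, with all coefficients at most `Q`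
in absolute value. -/
noncomputable def OmegaCount (n : ℕ) (Q : ℝ) (S : Set ℝ) : ℕ :=
  {α : ℝ | α ∈ S ∧ ∃ p : Polynomial ℤ, IsMinIntPoly α p ∧ p.Monic ∧ p.natDegree = n ∧
    ∀ i, (|p.coeff i| : ℝ) ≤ Q}.ncard

/-- `δ(n) = 1` for `n ≤ 2` and `δ(n) = 0` for `n ≥ 3`. -/
def deltaExp (n : ℕ) : ℕ := if n ≤ 2 then 1 else 0


lemma oc_count (Q : ℝ) (hQ : 0 ≤ Q) (J : Set ℝ) (hJ : J.OrdConnected) :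
    |∑ z ∈ Finset.Icc (-⌊Q⌋) ⌊Q⌋, J.indicator (fun _ => (1:ℝ)) (z:ℝ)
      - ∫ s in Set.Icc (-Q) Q, J.indicator (fun _ => (1:ℝ)) s| ≤ 1 := by
  classical
  have hm : MeasurableSet J := hJ.measurableSet
  rw [setIntegral_indicator hm, setIntegral_const, smul_eq_mul, mul_one]
  set A : Set ℝ := Set.Icc (-Q) Q ∩ J with hA
  have hAoc : A.OrdConnected := Set.ordConnected_Icc.inter hJ
  have hmem : ∀ z : ℤ, z ∈ Finset.Icc (-⌊Q⌋) ⌊Q⌋ ↔ (z:ℝ) ∈ Set.Icc (-Q) Q := by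
    intro z
    rw [Finset.mem_Icc, Set.mem_Icc, Int.le_floor]
    constructor
    · rintro ⟨h1, h2⟩
      refine ⟨?_, h2⟩
      have : -z ≤ ⌊Q⌋ := by lia
      rw [Int.le_floor] at this
      push_cast at this; linarith
    · rintro ⟨h1, h2⟩
      refine ⟨?_, h2⟩
      have : -z ≤ ⌊Q⌋ := by
        rw [Int.le_floor]; push_cast; linarith
      lia
  set T : Finset ℤ := (Finset.Icc (-⌊Q⌋) ⌊Q⌋).filter (fun z => (z:ℝ) ∈ J) with hT
  have hTA : ∀ z : ℤ, z ∈ T ↔ (z:ℝ) ∈ A := by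
    intro z
    rw [hT, Finset.mem_filter, hmem, hA]; rfl
  have hsum : ∑ z ∈ Finset.Icc (-⌊Q⌋) ⌊Q⌋, J.indicator (fun _ => (1:ℝ)) (z:ℝ) = (T.card : ℝ) := by
    rw [hT, Finset.card_filter]
    push_cast
    refine Finset.sum_congr rfl fun z _ => ?_
    by_cases h : (z:ℝ) ∈ J <;> simp [h]
  rw [hsum]
  have hAfin : volume A ≠ ⊤ := by
    apply ne_of_lt
    exact lt_of_le_of_lt (measure_mono Set.inter_subset_left) (by simp)
  rcases T.eq_empty_or_nonempty with h0 | hne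
  · rw [h0]
    rcases A.eq_empty_or_nonempty with hA0 | ⟨x, hx⟩
    · rw [hA0]; simp
    · have hsub : A ⊆ Set.Icc (⌊x⌋:ℝ) (⌊x⌋+1) := by
        intro y hy
        by_contra hcon
        rw [Set.mem_Icc, not_and_or, not_le, not_le] at hcon
        rcases hcon with h | h
        · have : (⌊x⌋:ℝ) ∈ A := hAoc.out hy hx ⟨h.le, Int.floor_le x⟩
          rw [← hTA, h0] at this; simp at this
        · have : ((⌊x⌋+1 : ℤ):ℝ) ∈ A := hAoc.out hx hy
            ⟨by push_cast; exact (Int.lt_floor_add_one x).le, by push_cast; exact h.le⟩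
          rw [← hTA, h0] at this; simp at this
      have h1 : volume.real A ≤ volume.real (Set.Icc (⌊x⌋:ℝ) (⌊x⌋+1)) :=
        measureReal_mono hsub (by simp)
      rw [Real.volume_real_Icc] at h1
      have h2 : max ((⌊x⌋:ℝ) + 1 - ⌊x⌋) 0 = 1 := by simp
      rw [h2] at h1
      have h3 : 0 ≤ volume.real A := measureReal_nonneg
      rw [abs_le]; simp; constructor <;> linarith
  · set a := T.min' hne
    set b := T.max' hne
    have ha : (a:ℝ) ∈ A := (hTA a).1 (T.min'_mem hne)
    have hb : (b:ℝ) ∈ A := (hTA b).1 (T.max'_mem hne)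
    have hab : a ≤ b := T.min'_le _ (T.max'_mem hne)
    have hTI : T = Finset.Icc a b := by
      ext z
      rw [Finset.mem_Icc]
      constructor
      · intro hz; exact ⟨T.min'_le _ hz, T.le_max' _ hz⟩
      · rintro ⟨h1, h2⟩
        rw [hTA]
        exact hAoc.out ha hb ⟨by exact_mod_cast h1, by exact_mod_cast h2⟩
    have hcard : (T.card : ℝ) = b - a + 1 := by
      rw [hTI, Int.card_Icc]
      have : ((b + 1 - a).toNat : ℤ) = b + 1 - a := Int.toNat_of_nonneg (by lia)
      have h' : (((b + 1 - a).toNat : ℤ) : ℝ) = ((b + 1 - a : ℤ) : ℝ) := by rw [this]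
      push_cast at h'
      linarith
    have hlo : volume.real (Set.Icc (a:ℝ) b) ≤ volume.real A :=
      measureReal_mono (hAoc.out ha hb) hAfin
    have hsub : A ⊆ Set.Icc ((a:ℝ)-1) (b+1) := by
      intro y hy
      by_contra hcon
      rw [Set.mem_Icc, not_and_or, not_le, not_le] at hcon
      rcases hcon with h | h
      · have : ((a-1 : ℤ):ℝ) ∈ A := hAoc.out hy ha ⟨by push_cast; exact h.le, by push_cast; linarith⟩
        rw [← hTA] at this
        have := T.min'_le _ this
        lia
      · have : ((b+1 : ℤ):ℝ) ∈ A := hAoc.out hb hy ⟨by push_cast; linarith, by push_cast; exact h.le⟩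
        rw [← hTA] at this
        have := T.le_max' _ this
        lia
    have hhi : volume.real A ≤ volume.real (Set.Icc ((a:ℝ)-1) (b+1)) :=
      measureReal_mono hsub (by simp)
    have habR : (a:ℝ) ≤ b := by exact_mod_cast hab
    rw [Real.volume_real_Icc_of_le (by linarith)] at hlo hhi
    rw [hcard, abs_le]; constructor <;> linarith

lemma telescoping (S : Finset ℤ) (μ : Measure ℝ) [IsFiniteMeasure μ] (M K B : ℝ)
    (hS : (S.card : ℝ) ≤ M) (hμ : μ.real Set.univ ≤ M) (hK : 0 ≤ K) :
    ∀ (d : ℕ) (F : (Fin d → ℝ) → ℝ), Measurable F → (∀ p, |F p| ≤ B) →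
      (∀ (i : Fin d) (p : Fin d → ℝ),
        |∑ z ∈ S, F (Function.update p i (z:ℝ)) - ∫ s, F (Function.update p i s) ∂μ| ≤ K) →
      |∑ v : Fin d → S, F (fun i => ((v i : ℤ) : ℝ)) - ∫ p, F p ∂(Measure.pi fun _ => μ)|
        ≤ d * K * M ^ (d - 1) := by
  have hM : 0 ≤ M := le_trans (Nat.cast_nonneg _) hS
  intro d
  induction d with
  | zero =>
    intro F _ _ _
    rw [Measure.pi_of_empty (x := fun i => i.elim0)]
    simp
    have : (fun i : Fin 0 => (((default : Fin 0 → S) i : ℤ) : ℝ)) = fun i => i.elim0 := by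
      ext i; exact i.elim0
    rw [this, sub_self]
  | succ d ih =>
    intro F hF hB hline
    have hcons : Measurable (fun q : ℝ × (Fin d → ℝ) => (Fin.cons q.1 q.2 : Fin (d+1) → ℝ)) := by
      rw [measurable_pi_iff]
      intro i
      refine Fin.cases ?_ (fun j => ?_) i
      · simpa using measurable_fst
      · simp only [Fin.cons_succ]; exact (measurable_pi_apply j).comp measurable_snd
    have hG : Measurable (fun q : ℝ × (Fin d → ℝ) => F (Fin.cons q.1 q.2)) := hF.comp hcons
    have hint : Integrable (fun q : ℝ × (Fin d → ℝ) => F (Fin.cons q.1 q.2))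
        (μ.prod (Measure.pi fun _ => μ)) :=
      Integrable.of_bound hG.aestronglyMeasurable B (Eventually.of_forall fun q => hB _)
    have hI : ∫ p, F p ∂(Measure.pi fun _ : Fin (d+1) => μ) =
        ∫ p' , ∫ s, F (Fin.cons s p') ∂μ ∂(Measure.pi fun _ : Fin d => μ) := by
      rw [← ((measurePreserving_piFinSuccAbove (fun _ : Fin (d+1) => μ) 0).symm).integral_comp']
      simp only [MeasurableEquiv.piFinSuccAbove_symm_apply, Fin.insertNthEquiv,
        Fin.insertNth_zero, Equiv.coe_fn_mk]
      rw [integral_prod_symm _ (by exact hint)]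
      rfl
    have hSsum : ∑ v : Fin (d+1) → S, F (fun i => ((v i : ℤ) : ℝ)) =
        ∑ z ∈ S, ∑ v : Fin d → S, F (Fin.cons (z:ℝ) (fun i => ((v i : ℤ) : ℝ))) := by
      rw [← (Fin.consEquiv (fun _ : Fin (d+1) => S)).sum_comp, Fintype.sum_prod_type,
        ← Finset.sum_coe_sort S]
      refine Finset.sum_congr rfl fun z _ => Finset.sum_congr rfl fun v _ => ?_
      congr 1
      ext i
      refine Fin.cases ?_ (fun j => ?_) i <;> simp [Fin.consEquiv]
    have hsec : ∀ z : ℝ, Measurable (fun p' : Fin d → ℝ => F (Fin.cons z p')) := fun z =>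
      hG.comp (measurable_const.prodMk measurable_id)
    have hsecI : ∀ z : ℝ, Integrable (fun p' : Fin d → ℝ => F (Fin.cons z p'))
        (Measure.pi fun _ : Fin d => μ) := fun z =>
      Integrable.of_bound (hsec z).aestronglyMeasurable B (Eventually.of_forall fun q => hB _)
    have h1 : ∀ z : ℝ, |∑ v : Fin d → S, F (Fin.cons z (fun i => ((v i : ℤ) : ℝ)))
        - ∫ p', F (Fin.cons z p') ∂(Measure.pi fun _ : Fin d => μ)| ≤ d * K * M ^ (d-1) := by
      intro z
      refine ih (fun p' => F (Fin.cons z p')) (hsec z) (fun p => hB _) ?_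
      intro i p
      have := hline i.succ (Fin.cons z p)
      simpa only [Fin.cons_update] using this
    have h2 : |∑ z ∈ S, ∫ p', F (Fin.cons (z:ℝ) p') ∂(Measure.pi fun _ : Fin d => μ)
        - ∫ p' , ∫ s, F (Fin.cons s p') ∂μ ∂(Measure.pi fun _ : Fin d => μ)| ≤ K * M ^ d := by
      rw [← integral_finsetSum S (fun (z:ℤ) _ => hsecI (z:ℝ)), ← integral_sub
        (integrable_finsetSum S (fun (z:ℤ) _ => hsecI (z:ℝ))) hint.integral_prod_right]
      rw [← Real.norm_eq_abs]
      refine (norm_integral_le_of_norm_le_const (C := K) (Eventually.of_forall fun p' => ?_)).trans ?_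
      · have := hline 0 (Fin.cons 0 p')
        simpa only [Fin.update_cons_zero, Real.norm_eq_abs] using this
      · refine mul_le_mul_of_nonneg_left ?_ hK
        rw [measureReal_def, Measure.pi_univ, ENNReal.toReal_prod]
        simp only [← measureReal_def, Finset.prod_const, Finset.card_univ, Fintype.card_fin]
        gcongr
    rw [hI, hSsum]
    have h3 : |∑ z ∈ S, ∑ v : Fin d → S, F (Fin.cons (z:ℝ) (fun i => ((v i : ℤ) : ℝ)))
        - ∑ z ∈ S, ∫ p', F (Fin.cons (z:ℝ) p') ∂(Measure.pi fun _ : Fin d => μ)|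
        ≤ d * K * M ^ d := by
      rw [← Finset.sum_sub_distrib]
      refine (Finset.abs_sum_le_sum_abs _ _).trans ?_
      refine (Finset.sum_le_sum fun (z:ℤ) _ => h1 (z:ℝ)).trans ?_
      rw [Finset.sum_const, nsmul_eq_mul]
      have : (S.card:ℝ) * (d * K * M ^ (d-1)) ≤ M * (d * K * M ^ (d-1)) := by gcongr
      refine this.trans (le_of_eq ?_)
      cases d with
      | zero => simp
      | succ e => simp only [Nat.add_sub_cancel]; ring
    refine (abs_sub_le _ _ _).trans ((add_le_add h3 h2).trans (le_of_eq ?_))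
    simp only [Nat.add_sub_cancel]; push_cast; ring

noncomputable def pol {R : Type*} [CommRing R] (d : ℕ) (p : Fin d → R) : Polynomial R :=
  Polynomial.X ^ d + ∑ i : Fin d, Polynomial.C (p i) * Polynomial.X ^ (i : ℕ)

section
variable {R : Type*} [CommRing R]

lemma pol_monic (d : ℕ) (p : Fin d → R) : (pol d p).Monic :=
  Polynomial.monic_X_pow_add (Polynomial.degree_sum_fin_lt p)

lemma pol_natDegree [Nontrivial R] (d : ℕ) (p : Fin d → R) : (pol d p).natDegree = d := by
  unfold pol
  rw [Polynomial.natDegree_add_eq_left_of_degree_lt]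
  · simp
  · rw [Polynomial.degree_X_pow]; exact Polynomial.degree_sum_fin_lt p

lemma pol_coeff (d : ℕ) (p : Fin d → R) (i : Fin d) : (pol d p).coeff i = p i := by
  unfold pol
  rw [Polynomial.coeff_add, Polynomial.finsetSum_coeff]
  simp only [Polynomial.coeff_C_mul, Polynomial.coeff_X_pow]
  rw [Finset.sum_eq_single i]
  · simp [i.2.ne]
  · intro b _ hb
    have : (i:ℕ) ≠ b := fun h => hb (Fin.ext h.symm)
    simp [this]
  · simp

lemma pol_of_monic (d : ℕ) (f : Polynomial R) (hf : f.Monic) (hd : f.natDegree = d) :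
    pol d (fun i => f.coeff i) = f := by
  conv_rhs => rw [hf.as_sum, hd, ← Fin.sum_univ_eq_sum_range (fun i => Polynomial.C (f.coeff i) * Polynomial.X ^ i) d]
  rfl

lemma pol_eval (d : ℕ) (p : Fin d → R) (x : R) :
    (pol d p).eval x = x ^ d + ∑ i : Fin d, p i * x ^ (i : ℕ) := by
  simp [pol, Polynomial.eval_finsetSum]

lemma pol_update (d : ℕ) (p : Fin d → R) (k : Fin d) (s : R) :
    pol d (Function.update p k s) = pol d (Function.update p k 0)
      + Polynomial.C s * Polynomial.X ^ (k : ℕ) := by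
  unfold pol
  rw [add_assoc]; congr 1
  rw [← Finset.add_sum_erase _ _ (Finset.mem_univ k), ← Finset.add_sum_erase (a := k) _
    (fun i => Polynomial.C (Function.update p k 0 i) * Polynomial.X ^ (i:ℕ)) (Finset.mem_univ k)]
  have : ∀ t : R, ∑ x ∈ Finset.univ.erase k, Polynomial.C (Function.update p k t x) * Polynomial.X ^ (x:ℕ)
    = ∑ x ∈ Finset.univ.erase k, Polynomial.C (p x) * Polynomial.X ^ (x:ℕ) := by
    intro t
    refine Finset.sum_congr rfl fun x hx => ?_
    rw [Function.update_of_ne (Finset.ne_of_mem_erase hx)]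
  rw [this, this]; simp; ring

lemma pol_map {S : Type*} [CommRing S] (φ : R →+* S) (d : ℕ) (p : Fin d → R) :
    (pol d p).map φ = pol d (fun i => φ (p i)) := by
  simp [pol, Polynomial.map_sum]
end

open Classical in
noncomputable def nrt (I : Set ℝ) (d : ℕ) (p : Fin d → ℝ) : ℕ :=
  ((pol d p).roots.toFinset.filter (· ∈ I)).card

noncomputable def sig (T : Finset ℝ) (x : ℝ) : T → SignType := fun a => SignType.sign (x - a)

lemma sig_oc (T : Finset ℝ) (σ : T → SignType) : {x | sig T x = σ}.OrdConnected := by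
  have : {x | sig T x = σ} = ⋂ a : T, {x : ℝ | SignType.sign (x - (a:ℝ)) = σ a} := by
    ext x; simp [sig, funext_iff]
  rw [this]
  refine Set.ordConnected_iInter fun a => ?_
  have hmono : Monotone (fun x : ℝ => SignType.sign (x - (a:ℝ))) := by
    intro x y hxy
    exact SignType.sign.monotone (sub_le_sub_right hxy _)
  exact Set.ordConnected_singleton.preimage_mono hmono

lemma pieces (n : ℕ) (g : Polynomial ℝ) (hg : g.Monic) (hgn : g.natDegree = n) (k : ℕ) (hk : k < n)
    (I : Set ℝ) (hI : I.OrdConnected) :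
    ∃ T : Finset ℝ, T.card ≤ n + 1 ∧ ∀ σ : T → SignType,
      (∀ s x y : ℝ, x ∈ I → y ∈ I → sig T x = σ → sig T y = σ → g.eval x + s * x ^ k = 0 →
        g.eval y + s * y ^ k = 0 → x = y) ∧
      {s : ℝ | ∃ x ∈ I, sig T x = σ ∧ g.eval x + s * x ^ k = 0}.OrdConnected := by
  classical
  set W : Polynomial ℝ := Polynomial.X * Polynomial.derivative g - Polynomial.C (k:ℝ) * g with hW
  have hWc : W.coeff n = (n:ℝ) - k := by
    have h1 : g.coeff n = 1 := by rw [← hgn]; exact hg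
    obtain ⟨m, rfl⟩ : ∃ m, n = m + 1 := ⟨n-1, by lia⟩
    rw [hW, Polynomial.coeff_sub, Polynomial.coeff_C_mul, Polynomial.coeff_X_mul,
      Polynomial.coeff_derivative, h1]
    push_cast; ring
  have hW0 : W ≠ 0 := by
    intro h
    rw [h, Polynomial.coeff_zero] at hWc
    have : (k:ℝ) < n := by exact_mod_cast hk
    linarith
  have hWdeg : W.natDegree ≤ n := by
    rw [hW]
    refine (Polynomial.natDegree_sub_le _ _).trans (max_le ?_ ?_)
    · refine Polynomial.natDegree_mul_le.trans ?_
      have := Polynomial.natDegree_derivative_le g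
      rw [Polynomial.natDegree_X]; lia
    · exact (Polynomial.natDegree_C_mul_le _ _).trans hgn.le
  refine ⟨insert 0 W.roots.toFinset, ?_, ?_⟩
  · refine (Finset.card_insert_le _ _).trans ?_
    have := (Multiset.toFinset_card_le W.roots).trans (Polynomial.card_roots' W)
    lia
  set T := insert 0 W.roots.toFinset with hT
  intro σ
  set A : Set ℝ := I ∩ {x | sig T x = σ} with hA
  have hAoc : A.OrdConnected := hI.inter (sig_oc T σ)
  by_cases hσ : ∃ a, σ a = 0
  · obtain ⟨a, ha⟩ := hσ
    have hx : ∀ x, sig T x = σ → x = a := by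
      intro x hx
      have := congrFun hx a
      rw [ha] at this
      simp only [sig, sign_eq_zero_iff] at this
      linarith
    refine ⟨fun s x y _ _ hx1 hy1 _ _ => (hx x hx1).trans (hx y hy1).symm, ?_⟩
    refine ⟨?_⟩
    rintro s ⟨x, hxI, hxs, hx0⟩ t ⟨y, hyI, hys, hy0⟩ u hu
    have hxa := hx x hxs
    have hya := hx y hys
    refine ⟨x, hxI, hxs, ?_⟩
    rw [hya, ← hxa] at hy0
    have hmul : (t - s) * x ^ k = 0 := by linarith
    rcases mul_eq_zero.1 hmul with h | h
    · have : u = s := le_antisymm (by linarith [hu.2]) hu.1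
      rw [this]; exact hx0
    · rw [h] at hx0 ⊢; linarith
  · push Not at hσ
    have hnT : ∀ x ∈ A, x ∉ T := by
      intro x hx hxT
      have h1 := congrFun hx.2 ⟨x, hxT⟩
      refine hσ ⟨x, hxT⟩ ?_
      rw [← h1]; simp [sig]
    have hn0 : ∀ x ∈ A, x ≠ 0 := by
      intro x hx h0
      exact hnT x hx (by rw [h0, hT]; simp)
    have hnW : ∀ x ∈ A, W.eval x ≠ 0 := by
      intro x hx h0
      refine hnT x hx ?_
      rw [hT, Finset.mem_insert, Multiset.mem_toFinset, Polynomial.mem_roots hW0]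
      exact Or.inr h0
    set h : ℝ → ℝ := fun x => - g.eval x / x ^ k with hh
    have hder : ∀ x, x ≠ 0 → HasDerivAt h
        ((-(Polynomial.derivative g).eval x * x ^ k - (-g.eval x) * (k * x ^ (k-1))) / (x^k)^2) x := by
      intro x hx
      have h1 := (g.hasDerivAt x).neg
      have h2 := hasDerivAt_pow k x
      exact h1.div h2 (pow_ne_zero _ hx)
    have hdne : ∀ x ∈ A, (-(Polynomial.derivative g).eval x * x ^ k
        - (-g.eval x) * (k * x ^ (k-1))) / (x^k)^2 ≠ 0 := by
      intro x hx h0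
      have hx0 := hn0 x hx
      rw [div_eq_zero_iff] at h0
      rcases h0 with h0 | h0
      · apply hnW x hx
        rw [hW]
        simp only [Polynomial.eval_sub, Polynomial.eval_mul, Polynomial.eval_X, Polynomial.eval_C]
        have h2 : x ^ k * (x * (Polynomial.derivative g).eval x - k * g.eval x) = 0 := by
          rcases Nat.eq_zero_or_pos k with hk0 | hk0
          · subst hk0; simp at h0 ⊢; right; exact h0
          · have : x ^ k = x ^ (k-1) * x := by rw [← pow_succ]; congr 1; lia
            rw [this] at h0 ⊢
            linear_combination (-x) * h0
        exact (mul_eq_zero.1 h2).resolve_left (pow_ne_zero _ hx0)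
      · exact (pow_ne_zero _ (pow_ne_zero _ hx0)) h0
    have hcont : ContinuousOn h A := fun x hx => (hder x (hn0 x hx)).continuousAt.continuousWithinAt
    have heq : ∀ s, ∀ x ∈ A, (g.eval x + s * x ^ k = 0 ↔ h x = s) := by
      intro s x hx
      have := pow_ne_zero k (hn0 x hx)
      rw [hh]; simp only
      rw [div_eq_iff this]
      constructor <;> intro h' <;> linarith
    have hlt : ∀ x ∈ A, ∀ y ∈ A, x < y → h x ≠ h y := by
      intro x hx y hy hxy he
      have hsub : Set.Icc x y ⊆ A := hAoc.out hx hy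
      obtain ⟨c, hc, hc0⟩ := exists_hasDerivAt_eq_zero hxy (hcont.mono hsub) he
        (fun z hz => hder z (hn0 z (hsub ⟨hz.1.le, hz.2.le⟩)))
      exact hdne c (hsub ⟨hc.1.le, hc.2.le⟩) hc0
    constructor
    · intro s x y hxI hyI hxs hys hx0 hy0
      rw [heq s x ⟨hxI, hxs⟩] at hx0
      rw [heq s y ⟨hyI, hys⟩] at hy0
      rcases lt_trichotomy x y with h' | h' | h'
      · exact absurd (hx0.trans hy0.symm) (hlt x ⟨hxI, hxs⟩ y ⟨hyI, hys⟩ h')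
      · exact h'
      · exact absurd (hy0.trans hx0.symm) (hlt y ⟨hyI, hys⟩ x ⟨hxI, hxs⟩ h')
    · have himg : {s : ℝ | ∃ x ∈ I, sig T x = σ ∧ g.eval x + s * x ^ k = 0} = h '' A := by
        ext s
        constructor
        · rintro ⟨x, hxI, hxs, h0⟩
          exact ⟨x, ⟨hxI, hxs⟩, (heq s x ⟨hxI, hxs⟩).1 h0⟩
        · rintro ⟨x, hx, h0⟩
          exact ⟨x, hx.1, hx.2, (heq s x hx).2 h0⟩
      rw [himg]
      exact (hAoc.isPreconnected.image h hcont).ordConnected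

lemma nrt_update (d : ℕ) (k : Fin d) (p : Fin d → ℝ) (I : Set ℝ) (hI : I.OrdConnected) :
    ∃ T : Finset ℝ, T.card ≤ d + 1 ∧
      (∀ σ : T → SignType, (∀ s x y : ℝ, x ∈ I → y ∈ I → sig T x = σ → sig T y = σ →
        (pol d (Function.update p k s)).eval x = 0 →
        (pol d (Function.update p k s)).eval y = 0 → x = y) ∧
      {s : ℝ | ∃ x ∈ I, sig T x = σ ∧ (pol d (Function.update p k s)).eval x = 0}.OrdConnected) ∧
      ∀ s, (nrt I d (Function.update p k s) : ℝ) = ∑ σ : T → SignType,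
        {s : ℝ | ∃ x ∈ I, sig T x = σ ∧ (pol d (Function.update p k s)).eval x = 0}.indicator
          (fun _ => (1:ℝ)) s := by
  classical
  obtain ⟨T, hT, h⟩ := pieces d (pol d (Function.update p k 0)) (pol_monic _ _) (pol_natDegree _ _)
    k k.2 I hI
  have hev : ∀ s x, (pol d (Function.update p k s)).eval x =
      (pol d (Function.update p k 0)).eval x + s * x ^ (k:ℕ) := by
    intro s x
    rw [pol_update]; simp
  simp only [← hev] at h
  refine ⟨T, hT, h, ?_⟩
  intro s
  unfold nrt
  rw [Finset.card_eq_sum_card_fiberwise (f := sig T) (t := Finset.univ) (fun _ _ => by simp)]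
  push_cast
  refine Finset.sum_congr rfl fun σ _ => ?_
  have hne : pol d (Function.update p k s) ≠ 0 := (pol_monic _ _).ne_zero
  by_cases hs : ∃ x ∈ I, sig T x = σ ∧ (pol d (Function.update p k s)).eval x = 0
  · rw [Set.indicator_of_mem (by exact hs)]
    obtain ⟨x, hxI, hxs, hx0⟩ := hs
    norm_cast
    rw [Finset.card_eq_one]
    refine ⟨x, ?_⟩
    ext y
    simp only [Finset.mem_filter, Multiset.mem_toFinset, Polynomial.mem_roots hne,
      Polynomial.IsRoot.def, Finset.mem_singleton]
    constructor
    · rintro ⟨⟨h1, h2⟩, h3⟩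
      exact (h σ).1 s y x h2 hxI h3 hxs h1 hx0
    · rintro rfl
      exact ⟨⟨hx0, hxI⟩, hxs⟩
  · rw [Set.indicator_of_notMem (by exact hs)]
    norm_cast
    rw [Finset.card_eq_zero, Finset.eq_empty_iff_forall_notMem]
    intro y hy
    simp only [Finset.mem_filter, Multiset.mem_toFinset, Polynomial.mem_roots hne,
      Polynomial.IsRoot.def] at hy
    exact hs ⟨y, hy.1.2, hy.2, hy.1.1⟩

lemma nrt_le (I : Set ℝ) (d : ℕ) (p : Fin d → ℝ) : nrt I d p ≤ d := by
  classical
  unfold nrt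
  refine (Finset.card_filter_le _ _).trans ((Multiset.toFinset_card_le _).trans
    ((Polynomial.card_roots' _).trans (pol_natDegree _ _).le))

lemma pol_eval_cont (d : ℕ) : Continuous (fun q : (Fin d → ℝ) × ℝ => (pol d q.1).eval q.2) := by
  simp only [pol_eval]
  fun_prop

lemma meas_hasroot (d : ℕ) (J : Set ℝ) (hJ : J.OrdConnected) :
    MeasurableSet {p : Fin d → ℝ | ∃ x ∈ J, (pol d p).eval x = 0} := by
  set D : Set ℝ := {x | x ∈ J ∧ (x ∈ Set.range ((↑) : ℚ → ℝ) ∨ IsLeast J x ∨ IsGreatest J x)} with hD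
  have hDc : D.Countable := by
    have h1 : (Set.range ((↑) : ℚ → ℝ)).Countable := Set.countable_range _
    have h2 : {x | IsLeast J x}.Countable :=
      Set.Subsingleton.countable (fun x hx y hy => IsLeast.unique hx hy)
    have h3 : {x | IsGreatest J x}.Countable :=
      Set.Subsingleton.countable (fun x hx y hy => IsGreatest.unique hx hy)
    exact (h1.union (h2.union h3)).mono (fun x hx => hx.2)
  have heq : {p : Fin d → ℝ | ∃ x ∈ J, (pol d p).eval x = 0} =
      ⋃ a ∈ D, ⋃ b ∈ D, {p : Fin d → ℝ | ∃ x ∈ Set.Icc a b, (pol d p).eval x = 0} := by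
    ext p
    simp only [Set.mem_iUnion, Set.mem_ofPred_eq, exists_prop]
    constructor
    · rintro ⟨x, hx, h0⟩
      have ha : ∃ a ∈ D, a ≤ x := by
        by_cases hl : IsLeast J x
        · exact ⟨x, ⟨hx, Or.inr (Or.inl hl)⟩, le_rfl⟩
        · have : ∃ y ∈ J, y < x := by
            by_contra hcon
            push Not at hcon
            exact hl ⟨hx, hcon⟩
          obtain ⟨y, hy, hyx⟩ := this
          obtain ⟨q, hq1, hq2⟩ := exists_rat_btwn hyx
          exact ⟨q, ⟨hJ.out hy hx ⟨hq1.le, hq2.le⟩, Or.inl ⟨q, rfl⟩⟩, hq2.le⟩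
      have hb : ∃ b ∈ D, x ≤ b := by
        by_cases hl : IsGreatest J x
        · exact ⟨x, ⟨hx, Or.inr (Or.inr hl)⟩, le_rfl⟩
        · have : ∃ y ∈ J, x < y := by
            by_contra hcon
            push Not at hcon
            exact hl ⟨hx, hcon⟩
          obtain ⟨y, hy, hyx⟩ := this
          obtain ⟨q, hq1, hq2⟩ := exists_rat_btwn hyx
          exact ⟨q, ⟨hJ.out hx hy ⟨hq1.le, hq2.le⟩, Or.inl ⟨q, rfl⟩⟩, hq1.le⟩
      obtain ⟨a, haD, hax⟩ := ha
      obtain ⟨b, hbD, hbx⟩ := hb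
      exact ⟨a, haD, b, hbD, x, ⟨hax, hbx⟩, h0⟩
    · rintro ⟨a, ha, b, hb, x, hx, h0⟩
      exact ⟨x, hJ.out ha.1 hb.1 hx, h0⟩
  rw [heq]
  refine MeasurableSet.biUnion hDc fun a _ => MeasurableSet.biUnion hDc fun b _ => ?_
  have hcl : IsClosed {q : (Fin d → ℝ) × Set.Icc a b | (pol d q.1).eval (q.2:ℝ) = 0} := by
    refine isClosed_eq ?_ continuous_const
    exact (pol_eval_cont d).comp (continuous_fst.prodMk (continuous_subtype_val.comp continuous_snd))
  have himg : {p : Fin d → ℝ | ∃ x ∈ Set.Icc a b, (pol d p).eval x = 0} =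
      Prod.fst '' {q : (Fin d → ℝ) × Set.Icc a b | (pol d q.1).eval (q.2:ℝ) = 0} := by
    ext p
    constructor
    · rintro ⟨x, hx, h0⟩
      exact ⟨(p, ⟨x, hx⟩), h0, rfl⟩
    · rintro ⟨⟨p', x⟩, h0, rfl⟩
      exact ⟨x, x.2, h0⟩
  rw [himg]
  exact (isClosedMap_fst_of_compactSpace _ hcl).measurableSet

lemma meas_nrt (d : ℕ) (I : Set ℝ) (hI : I.OrdConnected) :
    Measurable (fun p : Fin d → ℝ => (nrt I d p : ENNReal)) := by
  classical
  set A : ℕ → ℤ → Set (Fin d → ℝ) := fun j i =>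
    {p | ∃ x ∈ I ∩ {x : ℝ | ⌊((j:ℝ)+1) * x⌋ = i}, (pol d p).eval x = 0} with hA
  have hAm : ∀ j i, MeasurableSet (A j i) := by
    intro j i
    refine meas_hasroot d _ (hI.inter ?_)
    have hmono : Monotone (fun x : ℝ => ⌊((j:ℝ)+1) * x⌋) := by
      intro x y hxy
      exact Int.floor_mono (mul_le_mul_of_nonneg_left hxy (by positivity))
    exact Set.ordConnected_singleton.preimage_mono hmono
  have hE : ∀ j, Measurable (fun p => ∑' i : ℤ, (A j i).indicator (fun _ => (1:ENNReal)) p) := by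
    intro j
    exact Measurable.tsum fun i => measurable_const.indicator (hAm j i)
  refine measurable_of_tendsto_metrizable hE ?_
  rw [tendsto_pi_nhds]
  intro p
  apply tendsto_const_nhds.congr'
  set R := (pol d p).roots.toFinset.filter (· ∈ I) with hR
  have hne : pol d p ≠ 0 := (pol_monic _ _).ne_zero
  have hmR : ∀ x, x ∈ R ↔ x ∈ I ∧ (pol d p).eval x = 0 := by
    intro x
    rw [hR, Finset.mem_filter, Multiset.mem_toFinset, Polynomial.mem_roots hne, Polynomial.IsRoot.def,
      and_comm]
  have hinj : ∀ᶠ j : ℕ in atTop, ∀ x ∈ R, ∀ y ∈ R, x < y → ⌊((j:ℝ)+1) * x⌋ ≠ ⌊((j:ℝ)+1) * y⌋ := by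
    rw [eventually_all_finset]
    intro x _
    rw [eventually_all_finset]
    intro y _
    by_cases hxy : x < y
    · obtain ⟨N, hN⟩ := exists_nat_gt (1 / (y - x))
      filter_upwards [eventually_ge_atTop N] with j hj _
      have h0 : 0 < y - x := by linarith
      rw [div_lt_iff₀ h0] at hN
      have hj' : (N:ℝ) ≤ j := by exact_mod_cast hj
      have : 1 < ((j:ℝ)+1) * (y - x) := by nlinarith
      intro he
      have h1 := Int.floor_le (((j:ℝ)+1) * x)
      have h2 := Int.lt_floor_add_one (((j:ℝ)+1) * y)
      rw [← he] at h2
      nlinarith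
    · exact Eventually.of_forall fun j h => absurd h hxy
  filter_upwards [hinj] with j hj
  have h1 : ∑' i : ℤ, (A j i).indicator (fun _ => (1:ENNReal)) p =
      ∑ i ∈ R.image (fun x => ⌊((j:ℝ)+1) * x⌋), (1:ENNReal) := by
    rw [tsum_eq_sum (s := R.image (fun x => ⌊((j:ℝ)+1) * x⌋))]
    · refine Finset.sum_congr rfl fun i hi => ?_
      rw [Finset.mem_image] at hi
      obtain ⟨x, hx, hxi⟩ := hi
      rw [hmR] at hx
      exact Set.indicator_of_mem (show p ∈ A j i from ⟨x, ⟨hx.1, hxi⟩, hx.2⟩) _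
    · intro i hi
      refine Set.indicator_of_notMem ?_ _
      rintro ⟨x, ⟨hxI, hxi⟩, h0⟩
      exact hi (Finset.mem_image.2 ⟨x, (hmR x).2 ⟨hxI, h0⟩, hxi⟩)
  rw [h1, Finset.sum_const, Finset.card_image_of_injOn]
  · simp [nrt, hR]
  · intro x hx y hy hxy
    rcases lt_trichotomy x y with h | h | h
    · exact absurd hxy (hj x hx y hy h)
    · exact h
    · exact absurd hxy.symm (hj y hy x hx h)

noncomputable def FF (m : ℕ) (p : Fin m → ℝ) (t : ℝ) : ℝ :=
  t ^ (m+1) + ∑ i, p i * t ^ ((i:ℕ)+1)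

noncomputable def dFF (m : ℕ) (p : Fin m → ℝ) (t : ℝ) : ℝ :=
  (m+1 : ℝ) * t ^ m + ∑ i : Fin m, ((i:ℕ)+1 : ℝ) * p i * t ^ (i:ℕ)

lemma FF_deriv (m : ℕ) (p : Fin m → ℝ) (t : ℝ) : HasDerivAt (FF m p) (dFF m p t) t := by
  unfold FF dFF
  refine HasDerivAt.add ?_ (HasDerivAt.fun_sum fun i _ => ?_)
  · simpa using hasDerivAt_pow (m+1) t
  · have := (hasDerivAt_pow ((i:ℕ)+1) t).const_mul (p i)
    refine this.congr_deriv ?_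
    rw [Nat.add_sub_cancel]; push_cast; ring

lemma pol_cons (m : ℕ) (p : Fin m → ℝ) (s t : ℝ) :
    (pol (m+1) (Fin.cons s p : Fin (m+1) → ℝ)).eval t = FF m p t + s := by
  rw [pol_eval, Fin.sum_univ_succ]
  simp [FF]; ring

lemma FF_cont (m : ℕ) : Continuous (fun q : (Fin m → ℝ) × ℝ => FF m q.1 q.2) := by
  unfold FF; fun_prop
lemma dFF_cont (m : ℕ) : Continuous (fun q : (Fin m → ℝ) × ℝ => dFF m q.1 q.2) := by
  unfold dFF; fun_prop

lemma coarea (m : ℕ) (p : Fin m → ℝ) (Q : ℝ) (I : Set ℝ) (hI : I.OrdConnected) :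
    ∫⁻ s in Set.Icc (-Q) Q, (nrt I (m+1) (Fin.cons s p : Fin (m+1) → ℝ) : ENNReal) =
      ∫⁻ t in I ∩ {t | |FF m p t| ≤ Q}, ENNReal.ofReal |dFF m p t| := by
  classical
  obtain ⟨T, -, hinj, hN⟩ := nrt_update (m+1) 0 (Fin.cons 0 p) I hI
  simp only [Fin.update_cons_zero, pol_cons] at hinj hN
  set J : (T → SignType) → Set ℝ := fun σ => {s : ℝ | ∃ x ∈ I, sig T x = σ ∧ FF m p x + s = 0} with hJ
  have hN' : ∀ s, (nrt I (m+1) (Fin.cons s p : Fin (m+1) → ℝ) : ENNReal) =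
      ∑ σ, (J σ).indicator (fun _ => (1:ENNReal)) s := by
    intro s
    rw [← ENNReal.ofReal_natCast, hN s, ENNReal.ofReal_sum_of_nonneg]
    · refine Finset.sum_congr rfl fun σ _ => ?_
      by_cases h : s ∈ J σ
      · rw [Set.indicator_of_mem h, Set.indicator_of_mem h]; simp
      · rw [Set.indicator_of_notMem h, Set.indicator_of_notMem h]; simp
    · intro σ _
      exact Set.indicator_nonneg (fun _ _ => zero_le_one) _
  have hJm : ∀ σ, MeasurableSet (J σ) := fun σ => (hinj σ).2.measurableSet
  simp_rw [hN']
  rw [lintegral_finsetSum _ (fun σ _ => measurable_const.indicator (hJm σ))]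
  set A : (T → SignType) → Set ℝ := fun σ => (I ∩ {t | |FF m p t| ≤ Q}) ∩ {x | sig T x = σ} with hA
  have hFc : Continuous (FF m p) := continuous_iff_continuousAt.2 fun t => (FF_deriv m p t).continuousAt
  have hAm : ∀ σ, MeasurableSet (A σ) := by
    intro σ
    refine (hI.measurableSet.inter ?_).inter (sig_oc T σ).measurableSet
    exact (isClosed_le hFc.abs continuous_const).measurableSet
  have hU : I ∩ {t | |FF m p t| ≤ Q} = ⋃ σ ∈ (Finset.univ : Finset (T → SignType)), A σ := by
    ext x
    simp [hA]
  rw [hU, lintegral_biUnion_finset _ (fun σ _ => hAm σ)]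
  · refine Finset.sum_congr rfl fun σ _ => ?_
    have himg : J σ ∩ Set.Icc (-Q) Q = (fun x => - FF m p x) '' A σ := by
      ext s
      constructor
      · rintro ⟨⟨x, hxI, hxs, h0⟩, hs⟩
        refine ⟨x, ⟨⟨hxI, ?_⟩, hxs⟩, by simp only; linarith⟩
        simp only [Set.mem_ofPred_eq]
        rw [abs_le]; constructor <;> linarith [hs.1, hs.2]
      · rintro ⟨x, ⟨⟨hxI, hxQ⟩, hxs⟩, rfl⟩
        refine ⟨⟨x, hxI, hxs, by ring⟩, ?_⟩
        simp only [Set.mem_ofPred_eq] at hxQ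
        rw [abs_le] at hxQ
        constructor <;> linarith
    have hio : Set.InjOn (fun x => - FF m p x) (A σ) := by
      intro x hx y hy hxy
      simp only at hxy
      exact (hinj σ).1 (- FF m p x) x y hx.1.1 hy.1.1 hx.2 hy.2 (by ring) (by rw [hxy]; ring)
    have key := lintegral_image_eq_lintegral_abs_deriv_mul (hAm σ)
      (fun x _ => (FF_deriv m p x).neg.hasDerivWithinAt) hio (fun _ => 1)
    simp only [abs_neg, mul_one] at key
    rw [← key, lintegral_indicator (hJm σ), Measure.restrict_restrict (hJm σ), himg]
    rfl
  · intro σ _ τ _ hst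
    refine Set.disjoint_left.2 fun x hx hy => hst (hx.2.symm.trans hy.2)

def Eset (m : ℕ) (Q t : ℝ) : Set (Fin m → ℝ) :=
  {p | (∀ i, |p i| ≤ Q) ∧ |FF m p t| ≤ Q}

open scoped Pointwise in
lemma Eset_eq (m : ℕ) (Q t : ℝ) (hQ : 0 < Q) :
    Q • (Dset (m+1) Q⁻¹ t : Set (Fin m → ℝ)) = Eset m Q t := by
  ext p
  rw [Set.mem_smul_set_iff_inv_smul_mem₀ hQ.ne']
  have h1 : ∀ x : ℝ, |Q⁻¹ * x| ≤ 1 ↔ |x| ≤ Q := by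
    intro x
    rw [abs_mul, abs_of_pos (inv_pos.2 hQ), inv_mul_le_iff₀ hQ, mul_one]
  have h2 : Q⁻¹ * t ^ (m+1) + ∑ i : Fin m, (Q⁻¹ • p) i * t ^ ((i:ℕ)+1) = Q⁻¹ * FF m p t := by
    unfold FF
    rw [mul_add, Finset.mul_sum]
    congr 1
    refine Finset.sum_congr rfl fun i _ => ?_
    simp; ring
  constructor
  · rintro ⟨ha, hb⟩
    refine ⟨fun i => (h1 _).1 (ha i), (h1 _).1 ?_⟩
    rw [← h2]; exact hb
  · rintro ⟨ha, hb⟩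
    refine ⟨fun i => (h1 _).2 (ha i), ?_⟩
    have := (h1 _).2 hb
    rw [← h2] at this; exact this

lemma Eset_compact (m : ℕ) (Q t : ℝ) : IsCompact (Eset m Q t) := by
  have h1 : IsCompact (Set.univ.pi fun _ : Fin m => Set.Icc (-Q) Q) :=
    isCompact_univ_pi fun _ => isCompact_Icc
  refine h1.of_isClosed_subset ?_ ?_
  · have : Eset m Q t = (⋂ i, {p | |p i| ≤ Q}) ∩ {p | |FF m p t| ≤ Q} := by
      ext p; simp [Eset]
    rw [this]
    refine IsClosed.inter (isClosed_iInter fun i => ?_) ?_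
    · exact isClosed_le (continuous_apply i).abs continuous_const
    · refine isClosed_le ?_ continuous_const
      exact ((FF_cont m).comp (continuous_id.prodMk continuous_const)).abs
  · intro p hp i _
    exact abs_le.1 (hp.1 i)

open scoped Pointwise in
lemma omega_scale (m : ℕ) (Q t : ℝ) (hQ : 0 < Q) :
    Q ^ (m+1) * omegaFn (m+1) Q⁻¹ t = ∫ p in Eset m Q t, |dFF m p t| := by
  have h := Measure.setIntegral_comp_smul_of_pos (volume : Measure (Fin m → ℝ))
    (fun p => |dFF m p t|) (Dset (m+1) Q⁻¹ t) hQ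
  rw [Eset_eq m Q t hQ, Module.finrank_fin_fun, smul_eq_mul] at h
  have h2 : ∫ x in (Dset (m+1) Q⁻¹ t : Set (Fin m → ℝ)), |dFF m (Q • x) t| = Q * omegaFn (m+1) Q⁻¹ t := by
    unfold omegaFn
    rw [← integral_const_mul]
    congr 1
    ext p
    conv_rhs => rw [← abs_of_pos hQ]
    rw [← abs_mul, abs_of_pos hQ]
    congr 1
    unfold dFF
    rw [mul_add, Finset.mul_sum]
    congr 1
    · push_cast
      field_simp
    · refine Finset.sum_congr rfl fun i _ => ?_
      simp; ring
  replace h := h2.symm.trans h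
  have : Q ^ m ≠ 0 := by positivity
  rw [pow_succ, mul_assoc, h]
  field_simp

lemma omega_lint (m : ℕ) (Q t : ℝ) (hQ : 0 < Q) :
    Q ^ (m+1) * omegaFn (m+1) Q⁻¹ t = (∫⁻ p in Eset m Q t, ENNReal.ofReal |dFF m p t|).toReal ∧
    (∫⁻ p in Eset m Q t, ENNReal.ofReal |dFF m p t|) ≠ ⊤ := by
  have hint : IntegrableOn (fun p => |dFF m p t|) (Eset m Q t) := by
    refine ContinuousOn.integrableOn_compact (Eset_compact m Q t) (Continuous.continuousOn ?_)
    exact ((dFF_cont m).comp (continuous_id.prodMk continuous_const)).abs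
  have h := ofReal_integral_eq_lintegral_ofReal hint (Eventually.of_forall fun p => abs_nonneg _)
  rw [← h]
  refine ⟨?_, ENNReal.ofReal_ne_top⟩
  rw [ENNReal.toReal_ofReal (integral_nonneg fun p => abs_nonneg _)]
  exact omega_scale m Q t hQ

lemma main_integral (m : ℕ) (Q : ℝ) (hQ : 0 < Q) (I : Set ℝ) (hI : I.OrdConnected) :
    Q ^ (m+1) * ∫ t in I, omegaFn (m+1) Q⁻¹ t =
      ∫ p, (nrt I (m+1) p : ℝ) ∂(Measure.pi fun _ : Fin (m+1) => volume.restrict (Set.Icc (-Q) Q)) := by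
  set μ : Measure ℝ := volume.restrict (Set.Icc (-Q) Q) with hμ
  -- the joint integrand
  set B : Set ((Fin m → ℝ) × ℝ) := {q | |FF m q.1 q.2| ≤ Q} with hB
  have hBm : MeasurableSet B := (isClosed_le (FF_cont m).abs continuous_const).measurableSet
  set Φ : (Fin m → ℝ) × ℝ → ENNReal := B.indicator (fun q => ENNReal.ofReal |dFF m q.1 q.2|) with hΦ
  have hΦm : Measurable Φ :=
    (ENNReal.measurable_ofReal.comp (dFF_cont m).abs.measurable).indicator hBm
  have hpi : (Measure.pi fun _ : Fin m => μ) =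
      (volume : Measure (Fin m → ℝ)).restrict (Set.univ.pi fun _ => Set.Icc (-Q) Q) := by
    rw [hμ, ← Measure.restrict_pi_pi]; rfl
  have hbox : MeasurableSet (Set.univ.pi fun _ : Fin m => Set.Icc (-Q) Q) :=
    MeasurableSet.univ_pi fun _ => measurableSet_Icc
  have hE : ∀ t, ∫⁻ p in Eset m Q t, ENNReal.ofReal |dFF m p t| =
      ∫⁻ p, Φ (p, t) ∂(Measure.pi fun _ : Fin m => μ) := by
    intro t
    have h1 : (fun p => Φ (p, t)) = {p | |FF m p t| ≤ Q}.indicator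
        (fun p => ENNReal.ofReal |dFF m p t|) := by
      ext p
      by_cases h : |FF m p t| ≤ Q
      · rw [hΦ, Set.indicator_of_mem (by exact h), Set.indicator_of_mem (by exact h)]
      · rw [hΦ, Set.indicator_of_notMem (by exact h), Set.indicator_of_notMem (by exact h)]
    have hm : MeasurableSet {p : Fin m → ℝ | |FF m p t| ≤ Q} :=
      (isClosed_le (((FF_cont m).comp (continuous_id.prodMk continuous_const)).abs)
        continuous_const).measurableSet
    rw [h1, hpi, lintegral_indicator hm, Measure.restrict_restrict hm]
    congr 2
    ext p
    simp only [Eset, Set.mem_ofPred_eq, Set.mem_inter_iff, Set.mem_univ_pi, Set.mem_Icc, abs_le]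
    tauto
  have hL : ∫⁻ p, (nrt I (m+1) p : ENNReal) ∂(Measure.pi fun _ : Fin (m+1) => μ) =
      ∫⁻ t in I, ∫⁻ p in Eset m Q t, ENNReal.ofReal |dFF m p t| := by
    rw [← ((measurePreserving_piFinSuccAbove (fun _ : Fin (m+1) => μ) 0).symm).lintegral_comp
      (meas_nrt (m+1) I hI)]
    simp only [MeasurableEquiv.piFinSuccAbove_symm_apply, Fin.insertNthEquiv,
        Fin.insertNth_zero, Equiv.coe_fn_mk]
    have hcons : Measurable (fun q : ℝ × (Fin m → ℝ) => (Fin.cons q.1 q.2 : Fin (m+1) → ℝ)) := by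
      rw [measurable_pi_iff]
      intro i
      refine Fin.cases ?_ (fun j => ?_) i
      · simpa using measurable_fst
      · simp only [Fin.cons_succ]; exact (measurable_pi_apply j).comp measurable_snd
    have hmm := (meas_nrt (m+1) I hI).comp hcons
    rw [lintegral_prod_symm _ (by exact hmm.aemeasurable)]
    simp_rw [hE]
    rw [lintegral_lintegral_swap (μ := volume.restrict I) (by
      exact (hΦm.comp measurable_swap).aemeasurable)]
    refine lintegral_congr fun p => ?_
    refine (coarea m p Q I hI).trans ?_
    have hm : MeasurableSet {t : ℝ | |FF m p t| ≤ Q} :=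
      (isClosed_le (((FF_cont m).comp (continuous_const.prodMk continuous_id)).abs)
        continuous_const).measurableSet
    rw [Set.inter_comm, ← Measure.restrict_restrict hm, ← lintegral_indicator hm]
    refine lintegral_congr fun t => ?_
    by_cases h : |FF m p t| ≤ Q
    · rw [hΦ, Set.indicator_of_mem (by exact h), Set.indicator_of_mem (by exact h)]
    · rw [hΦ, Set.indicator_of_notMem (by exact h), Set.indicator_of_notMem (by exact h)]
  rw [← integral_const_mul]
  have hmE : Measurable (fun t => ∫⁻ p in Eset m Q t, ENNReal.ofReal |dFF m p t|) := by
    simp_rw [hE]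
    exact hΦm.lintegral_prod_left'
  calc ∫ t in I, Q ^ (m+1) * omegaFn (m+1) Q⁻¹ t
      = ∫ t in I, (∫⁻ p in Eset m Q t, ENNReal.ofReal |dFF m p t|).toReal := by
        refine integral_congr_ae (Eventually.of_forall fun t => ?_)
        exact (omega_lint m Q t hQ).1
    _ = (∫⁻ t in I, ∫⁻ p in Eset m Q t, ENNReal.ofReal |dFF m p t|).toReal :=
        integral_toReal hmE.aemeasurable
          (Eventually.of_forall fun t => lt_top_iff_ne_top.2 (omega_lint m Q t hQ).2)
    _ = (∫⁻ p, (nrt I (m+1) p : ENNReal) ∂(Measure.pi fun _ : Fin (m+1) => μ)).toReal := by rw [hL]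
    _ = ∫ p, (nrt I (m+1) p : ENNReal).toReal ∂(Measure.pi fun _ : Fin (m+1) => μ) := by
        rw [integral_toReal (meas_nrt (m+1) I hI).aemeasurable
          (Eventually.of_forall fun t => ENNReal.natCast_lt_top _)]
    _ = _ := by simp

lemma lattice_integral (n : ℕ) (Q : ℝ) (hQ : 1 ≤ Q) (I : Set ℝ) (hI : I.OrdConnected) :
    |∑ v : Fin n → Finset.Icc (-⌊Q⌋) ⌊Q⌋, (nrt I n (fun i => ((v i : ℤ) : ℝ)) : ℝ)
      - ∫ p, (nrt I n p : ℝ) ∂(Measure.pi fun _ : Fin n => volume.restrict (Set.Icc (-Q) Q))|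
      ≤ n * 3 ^ (n+1) * (3 * Q) ^ (n-1) := by
  refine telescoping (Finset.Icc (-⌊Q⌋) ⌊Q⌋) _ (3*Q) (3^(n+1)) n ?_ ?_ (by positivity) n
    (fun p => (nrt I n p : ℝ)) ?_ ?_ ?_
  · rw [Int.card_Icc]
    have h0 : 0 ≤ ⌊Q⌋ := Int.floor_nonneg.2 (by linarith)
    have : ((⌊Q⌋ + 1 - -⌊Q⌋).toNat : ℤ) = ⌊Q⌋ + 1 - -⌊Q⌋ := Int.toNat_of_nonneg (by lia)
    have h' : (((⌊Q⌋ + 1 - -⌊Q⌋).toNat : ℤ) : ℝ) = ((⌊Q⌋ + 1 - -⌊Q⌋ : ℤ) : ℝ) := by rw [this]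
    push_cast at h'
    rw [h']
    linarith [Int.floor_le Q]
  · rw [measureReal_restrict_apply_univ, Real.volume_real_Icc_of_le (by linarith)]
    linarith
  · have := (meas_nrt n I hI).ennreal_toReal
    simpa using this
  · intro p
    rw [Nat.abs_cast]; exact_mod_cast nrt_le I n p
  · intro i p
    obtain ⟨T, hT, hoc, hN⟩ := nrt_update n i p I hI
    simp_rw [hN]
    rw [Finset.sum_comm, integral_finsetSum, ← Finset.sum_sub_distrib]
    · refine (Finset.abs_sum_le_sum_abs _ _).trans ?_
      refine (Finset.sum_le_sum fun σ _ => oc_count Q (by linarith) _ (hoc σ).2).trans ?_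
      simp only [Finset.sum_const, Finset.card_univ, Fintype.card_fun, Fintype.card_coe, nsmul_eq_mul,
        mul_one]
      have : Fintype.card SignType = 3 := rfl
      rw [this]
      push_cast
      exact pow_le_pow_right₀ (by norm_num) hT
    · intro σ _
      exact (integrable_const (1:ℝ)).indicator (hoc σ).2.measurableSet

lemma mahler_bound (n : ℕ) (f g : Polynomial ℤ) (hf : f.Monic) (hg : g.Monic)
    (hn : f.natDegree + g.natDegree = n) (Q : ℝ) (h : ∀ i, |((f * g).coeff i : ℝ)| ≤ Q)
    (i j : ℕ) : max 1 |(g.coeff i : ℝ)| * |(f.coeff j : ℝ)| ≤ 4 ^ n * (n+1) * Q ∧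
      |(g.coeff i : ℝ)| ≤ 4 ^ n * (n+1) * Q := by
  set v : ℤ →+* ℂ := Int.castRingHom ℂ
  have hv : Isometry v := by
    refine Isometry.of_dist_eq fun x y => ?_
    rw [dist_eq_norm, dist_eq_norm, ← map_sub]
    rw [Int.norm_eq_abs]; exact Complex.norm_intCast (x - y)
  have hfg : (f * g).natDegree = n := by rw [hf.natDegree_mul hg, hn]
  have hQ : 0 ≤ Q := (abs_nonneg _).trans (h 0)
  have hM : f.mapMahlerMeasure v * g.mapMahlerMeasure v ≤ (n+1) * Q := by
    rw [← Polynomial.mapMahlerMeasure_mul]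
    refine (Polynomial.mapMahlerMeasure_le_sum_norm_coeff (f*g) v hv).trans ?_
    rw [Polynomial.sum_def]
    calc ∑ i ∈ (f*g).support, ‖(f*g).coeff i‖ ≤ ∑ i ∈ Finset.range (n+1), ‖(f*g).coeff i‖ := by
          refine Finset.sum_le_sum_of_subset_of_nonneg ?_ fun _ _ _ => norm_nonneg _
          rw [← hfg]; exact Polynomial.supp_subset_range_natDegree_succ
      _ ≤ ∑ i ∈ Finset.range (n+1), Q := by
          refine Finset.sum_le_sum fun i _ => ?_
          rw [Int.norm_eq_abs]; exact h i
      _ = _ := by simp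
  have hf1 := hf.one_le_mapMahlerMeasure v hv
  have hg1 := hg.one_le_mapMahlerMeasure v hv
  have hco : ∀ (q : Polynomial ℤ), q.natDegree ≤ n → ∀ k, |(q.coeff k : ℝ)| ≤ 2 ^ n * q.mapMahlerMeasure v := by
    intro q hq k
    have h1 := Polynomial.norm_coeff_le_choose_mul_mapMahlerMeasure v hv k q
    rw [Int.norm_eq_abs] at h1
    refine h1.trans ?_
    have h2 : (q.natDegree.choose k : ℝ) ≤ 2 ^ n := by
      have : q.natDegree.choose k ≤ 2 ^ n := (Nat.choose_le_two_pow _ _).trans (Nat.pow_le_pow_right (by norm_num) hq)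
      exact_mod_cast this
    exact mul_le_mul_of_nonneg_right h2 (Polynomial.mapMahlerMeasure_nonneg _ _)
  have hfj := hco f (by lia) j
  have hgi := hco g (by lia) i
  have h2n : (1:ℝ) ≤ 2 ^ n := one_le_pow₀ (by norm_num)
  have hmax : max 1 |(g.coeff i : ℝ)| ≤ 2 ^ n * g.mapMahlerMeasure v := by
    refine max_le ?_ hgi
    nlinarith
  have h4 : (4:ℝ) ^ n = 2 ^ n * 2 ^ n := by rw [← mul_pow]; norm_num
  constructor
  · calc max 1 |(g.coeff i : ℝ)| * |(f.coeff j : ℝ)|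
        ≤ (2 ^ n * g.mapMahlerMeasure v) * (2 ^ n * f.mapMahlerMeasure v) := by gcongr
      _ = 4 ^ n * (f.mapMahlerMeasure v * g.mapMahlerMeasure v) := by rw [h4]; ring
      _ ≤ 4 ^ n * ((n+1) * Q) := by gcongr
      _ = _ := by ring
  · calc |(g.coeff i : ℝ)| ≤ 2 ^ n * g.mapMahlerMeasure v := hgi
      _ ≤ 4 ^ n * (f.mapMahlerMeasure v * g.mapMahlerMeasure v) := by
          rw [h4]
          have : g.mapMahlerMeasure v ≤ f.mapMahlerMeasure v * g.mapMahlerMeasure v := by nlinarith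
          have h5 : (2:ℝ)^n ≤ 2^n * 2^n := by nlinarith
          gcongr
      _ ≤ 4 ^ n * ((n+1) * Q) := by gcongr
      _ = _ := by ring

lemma sum_int_le (φ : ℕ → ℝ) (hφ : ∀ i, 0 ≤ φ i) (B : ℤ) :
    ∑ z ∈ Finset.Icc (-B) B, φ z.natAbs ≤ 2 * ∑ i ∈ Finset.range (B.toNat + 1), φ i := by
  classical
  have hsub : Finset.Icc (-B) B ⊆ (Finset.range (B.toNat+1)).image (fun i : ℕ => (i:ℤ)) ∪
      (Finset.range (B.toNat+1)).image (fun i : ℕ => -(i:ℤ)) := by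
    intro z hz
    rw [Finset.mem_Icc] at hz
    rw [Finset.mem_union, Finset.mem_image, Finset.mem_image]
    rcases le_total 0 z with h | h
    · left; exact ⟨z.toNat, by rw [Finset.mem_range]; lia, by lia⟩
    · right; exact ⟨(-z).toNat, by rw [Finset.mem_range]; lia, by lia⟩
  refine (Finset.sum_le_sum_of_subset_of_nonneg hsub fun _ _ _ => hφ _).trans ?_
  refine (le_of_le_of_eq (le_add_of_nonneg_right (Finset.sum_nonneg fun _ _ => hφ _)) 
    (Finset.sum_union_inter (f := fun z : ℤ => φ z.natAbs))).trans ?_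
  rw [two_mul, Finset.sum_image (by intro a _ b _ h; simpa using h),
    Finset.sum_image (by intro a _ b _ h; simpa using h)]
  simp

lemma log_half (Q : ℝ) (hQ : 2 ≤ Q) : 1/2 ≤ Real.log Q := by
  have h1 : Real.log 2 ≤ Real.log Q := Real.log_le_log (by norm_num) hQ
  linarith [Real.log_two_gt_d9]

lemma recip_sum (n e : ℕ) (he1 : 1 ≤ e) (he : 3 ≤ n → 2 ≤ e) (c : ℝ) (hc : 1 ≤ c) :
    ∃ C : ℝ, 0 < C ∧ ∀ Q : ℝ, 2 ≤ Q →
      ∑ z ∈ Finset.Icc (-⌊c*Q⌋) ⌊c*Q⌋, (1 / max 1 |(z:ℝ)|) ^ e ≤ C * Real.log Q ^ deltaExp n := by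
  have hred : ∀ Q : ℝ, ∑ z ∈ Finset.Icc (-⌊c*Q⌋) ⌊c*Q⌋, (1 / max 1 |(z:ℝ)|) ^ e ≤
      2 * (1 + ∑ i ∈ Finset.range ⌊c*Q⌋.toNat, (1 / ((i:ℝ)+1)) ^ e) := by
    intro Q
    have h := sum_int_le (fun i => (1 / max 1 (i:ℝ)) ^ e) (fun i => by positivity) ⌊c*Q⌋
    rw [Finset.sum_range_succ'] at h
    have h2 : ∀ i : ℕ, max 1 (((i+1 : ℕ)):ℝ) = (i:ℝ)+1 := by
      intro i; push_cast; rw [max_eq_right]; linarith [Nat.cast_nonneg (α := ℝ) i]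
    simp only [h2] at h
    simp only [Nat.cast_natAbs, Int.cast_abs] at h
    refine h.trans (le_of_eq ?_)
    simp; ring
  by_cases hn : n ≤ 2
  · refine ⟨2 * (5 + 2 * Real.log c), by have := Real.log_nonneg hc; positivity, fun Q hQ => ?_⟩
    refine (hred Q).trans ?_
    have hlog := log_half Q hQ
    have hcQ : 1 ≤ c * Q := by nlinarith
    have hlc := Real.log_nonneg hc
    have hfl : 1 ≤ ⌊c*Q⌋ := by rw [Int.le_floor]; simpa using hcQ
    have h1 : ∑ i ∈ Finset.range ⌊c*Q⌋.toNat, (1 / ((i:ℝ)+1)) ^ e ≤ 1 + Real.log c + Real.log Q := by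
      calc ∑ i ∈ Finset.range ⌊c*Q⌋.toNat, (1 / ((i:ℝ)+1)) ^ e
          ≤ ∑ i ∈ Finset.range ⌊c*Q⌋.toNat, ((i:ℝ)+1)⁻¹ := by
            refine Finset.sum_le_sum fun i _ => ?_
            rw [← one_div]
            have h0 : (0:ℝ) ≤ 1 / ((i:ℝ)+1) := by positivity
            have h01 : 1 / ((i:ℝ)+1) ≤ 1 := by
              rw [div_le_one (by positivity)]; linarith [Nat.cast_nonneg (α := ℝ) i]
            exact pow_le_of_le_one h0 h01 (by lia)
        _ = ((harmonic ⌊c*Q⌋.toNat : ℚ) : ℝ) := by simp [harmonic]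
        _ ≤ 1 + Real.log (⌊c*Q⌋.toNat : ℝ) := harmonic_le_one_add_log _
        _ ≤ 1 + Real.log (c * Q) := by
            have h3 : ((⌊c*Q⌋.toNat : ℕ) : ℝ) = (⌊c*Q⌋ : ℝ) := by
              have : ((⌊c*Q⌋.toNat : ℕ) : ℤ) = ⌊c*Q⌋ := Int.toNat_of_nonneg (by lia)
              exact_mod_cast this
            rw [h3]
            have : (0:ℝ) < (⌊c*Q⌋ : ℝ) := by exact_mod_cast (by lia : 0 < ⌊c*Q⌋)
            linarith [Real.log_le_log this (Int.floor_le (c*Q))]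
        _ = _ := by rw [Real.log_mul (by linarith) (by linarith)]; ring
    simp only [deltaExp, hn, if_true, pow_one]
    nlinarith
  · have he2 : 2 ≤ e := he (by lia)
    have hs : Summable (fun i : ℕ => (1 / ((i:ℝ)+1)) ^ 2) := by
      have := (summable_nat_add_iff 1).2 (Real.summable_one_div_nat_pow.2 (one_lt_two))
      simpa [div_pow] using this
    refine ⟨2 * (1 + ∑' i : ℕ, (1 / ((i:ℝ)+1)) ^ 2), ?_, fun Q hQ => ?_⟩
    · have : 0 ≤ ∑' i : ℕ, (1 / ((i:ℝ)+1)) ^ 2 := tsum_nonneg fun i => by positivity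
      positivity
    · simp only [deltaExp, hn, if_false, pow_zero, mul_one]
      refine (hred Q).trans ?_
      gcongr
      calc ∑ i ∈ Finset.range ⌊c*Q⌋.toNat, (1 / ((i:ℝ)+1)) ^ e
          ≤ ∑ i ∈ Finset.range ⌊c*Q⌋.toNat, (1 / ((i:ℝ)+1)) ^ 2 := by
            refine Finset.sum_le_sum fun i _ => ?_
            have h01 : 1 / ((i:ℝ)+1) ≤ 1 := by
              rw [div_le_one (by positivity)]; linarith [Nat.cast_nonneg (α := ℝ) i]
            exact pow_le_pow_of_le_one (by positivity) h01 he2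
        _ ≤ _ := hs.sum_le_tsum _ (fun i _ => by positivity)

open Classical in
lemma red_count_j (n j : ℕ) (hj : 2 * (j+1) ≤ n) :
    ∃ C : ℝ, 0 < C ∧ ∀ Q : ℝ, 2 ≤ Q →
      ((Finset.univ.filter fun v : Fin n → Finset.Icc (-⌊Q⌋) ⌊Q⌋ =>
        ∃ f g : Polynomial ℤ, f.Monic ∧ g.Monic ∧ f * g = pol n (fun i => (v i : ℤ)) ∧
          g.natDegree = j + 1).card : ℝ) ≤ C * Q ^ (n-1) * Real.log Q ^ deltaExp n := by
  obtain ⟨e, he⟩ : ∃ e, n = e + (j+1) := ⟨n - (j+1), by lia⟩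
  have hc : (1:ℝ) ≤ 4 ^ n * (n+1) := by
    have : (1:ℝ) ≤ 4 ^ n := one_le_pow₀ (by norm_num)
    have h2 : (1:ℝ) ≤ n + 1 := by have := Nat.cast_nonneg (α := ℝ) n; linarith
    nlinarith
  set c : ℝ := 4 ^ n * (n+1) with hcdef
  obtain ⟨C, hC, hCQ⟩ := recip_sum n e (by lia) (by lia) c hc
  refine ⟨(3*c)^(n-1) * C, by positivity, fun Q hQ => ?_⟩
  set B : ℤ := ⌊c*Q⌋
  set b : ℤ → ℤ := fun z => ⌊c*Q / max 1 |(z:ℝ)|⌋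
  set W := (Finset.univ.filter fun v : Fin n → Finset.Icc (-⌊Q⌋) ⌊Q⌋ =>
        ∃ f g : Polynomial ℤ, f.Monic ∧ g.Monic ∧ f * g = pol n (fun i => (v i : ℤ)) ∧
          g.natDegree = j + 1)
  set S : Finset (Σ _ : ℤ, (Fin j → ℤ) × (Fin e → ℤ)) := (Finset.Icc (-B) B).sigma (fun z =>
    Fintype.piFinset (fun _ : Fin j => Finset.Icc (-B) B) ×ˢ
      Fintype.piFinset (fun _ : Fin e => Finset.Icc (-b z) (b z)))
  have hinj : Function.Injective
      (fun v : Fin n → Finset.Icc (-⌊Q⌋) ⌊Q⌋ => (pol n (fun i => (v i : ℤ)) : Polynomial ℤ)) := by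
    intro v w h
    ext i
    have := congrArg (fun p => Polynomial.coeff p i) h
    simpa [pol_coeff] using this
  have hicc : ∀ (x : ℤ) (y : ℝ), |(x:ℝ)| ≤ y → x ∈ Finset.Icc (-⌊y⌋) ⌊y⌋ := by
    intro x y h
    rw [abs_le] at h
    rw [Finset.mem_Icc, Int.le_floor]
    refine ⟨?_, h.2⟩
    rw [neg_le, Int.le_floor]; push_cast; linarith
  have hcard : W.card ≤ S.card := by
    rw [← Finset.card_image_of_injective W hinj]
    refine (Finset.card_le_card (t := S.image (fun s => pol e s.2.2 *
      pol (j+1) (Fin.cons s.1 s.2.1 : Fin (j+1) → ℤ))) ?_).trans Finset.card_image_le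
    intro p hp
    obtain ⟨v, hv, rfl⟩ := Finset.mem_image.1 hp
    obtain ⟨f, g, hf, hg, hfg, hgd⟩ := (Finset.mem_filter.1 hv).2
    have hfd : f.natDegree = e := by
      have := hf.natDegree_mul hg
      rw [hfg, pol_natDegree] at this
      lia
    have hco : ∀ i, |((f * g).coeff i : ℝ)| ≤ Q := by
      intro i
      rw [hfg]
      rcases lt_trichotomy i n with h | h | h
      · have := pol_coeff n (fun i => (v i : ℤ)) ⟨i, h⟩
        simp only at this
        rw [this]
        have h2 := Finset.mem_Icc.1 (v ⟨i, h⟩).2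
        have h3 : (|((v ⟨i, h⟩ : ℤ))| : ℤ) ≤ ⌊Q⌋ := abs_le.2 h2
        have := Int.le_floor.1 h3
        simpa using this
      · have : (pol n (fun i => (v i : ℤ))).coeff i = 1 := by
          have h1 := pol_monic n (fun i => (v i : ℤ))
          rw [Polynomial.Monic, Polynomial.leadingCoeff, pol_natDegree] at h1
          rw [h, h1]
        rw [this]; norm_num; linarith
      · rw [Polynomial.coeff_eq_zero_of_natDegree_lt (by rw [pol_natDegree]; exact h)]
        simp; linarith
    have hM := mahler_bound n f g hf hg (by lia) Q hco
    refine Finset.mem_image.2 ⟨⟨g.coeff 0, fun i => g.coeff (i+1), fun i => f.coeff i⟩, ?_, ?_⟩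
    · refine Finset.mem_sigma.2 ⟨hicc _ _ (hM 0 0).2, Finset.mem_product.2 ⟨?_, ?_⟩⟩
      · exact Fintype.mem_piFinset.2 fun i => hicc _ _ (hM _ 0).2
      · refine Fintype.mem_piFinset.2 fun i => hicc _ _ ?_
        rw [le_div_iff₀ (by positivity), mul_comm]
        exact (hM 0 _).1
    · simp only
      have h1 : (Fin.cons (g.coeff 0) (fun i : Fin j => g.coeff (i+1)) : Fin (j+1) → ℤ) =
          fun i : Fin (j+1) => g.coeff i := by
        ext i; refine Fin.cases ?_ (fun i => ?_) i <;> simp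
      rw [h1, pol_of_monic e f hf hfd, pol_of_monic (j+1) g hg hgd, hfg]
  have hw : ∀ y : ℝ, 0 ≤ y → ((Finset.Icc (-⌊y⌋) ⌊y⌋).card : ℝ) ≤ 2*y+1 := by
    intro y hy
    rw [Int.card_Icc]
    have h0 := Int.floor_nonneg.2 hy
    have : (((⌊y⌋ + 1 - -⌊y⌋).toNat : ℤ) : ℝ) = 2 * ⌊y⌋ + 1 := by
      rw [Int.toNat_of_nonneg (by lia)]; push_cast; ring
    have h2 : (((⌊y⌋ + 1 - -⌊y⌋).toNat : ℕ) : ℝ) = 2 * ⌊y⌋ + 1 := by exact_mod_cast this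
    rw [h2]
    have := Int.floor_le y
    linarith
  have hcQ : 1 ≤ c * Q := by nlinarith
  have hS : (S.card : ℝ) ≤ ∑ z ∈ Finset.Icc (-B) B, (3*c*Q)^(n-1) * (1 / max 1 |(z:ℝ)|)^e := by
    rw [Finset.card_sigma]
    push_cast
    refine Finset.sum_le_sum fun z hz => ?_
    rw [Finset.card_product, Fintype.card_piFinset, Fintype.card_piFinset]
    simp only [Finset.prod_const, Finset.card_univ, Fintype.card_fin]
    push_cast
    have h1 : ((Finset.Icc (-B) B).card : ℝ) ≤ 3*c*Q := (hw _ (by linarith)).trans (by linarith)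
    rw [Finset.mem_Icc] at hz
    have hz1 : |(z:ℝ)| ≤ c * Q := by
      have h3 : (|z| : ℤ) ≤ B := abs_le.2 hz
      have := Int.le_floor.1 h3
      simpa using this
    have hm : 0 < max 1 |(z:ℝ)| := by positivity
    have hq : 1 ≤ c*Q / max 1 |(z:ℝ)| := by
      rw [le_div_iff₀ hm, one_mul]; exact max_le hcQ hz1
    have h2 : ((Finset.Icc (-b z) (b z)).card : ℝ) ≤ 3*c*Q * (1 / max 1 |(z:ℝ)|) := by
      refine (hw _ (by linarith)).trans ?_
      have : 3*c*Q * (1 / max 1 |(z:ℝ)|) = 3 * (c*Q / max 1 |(z:ℝ)|) := by ring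
      linarith
    calc ((Finset.Icc (-B) B).card : ℝ) ^ j * ((Finset.Icc (-b z) (b z)).card : ℝ) ^ e
        ≤ (3*c*Q)^j * (3*c*Q * (1 / max 1 |(z:ℝ)|))^e := by gcongr
      _ = (3*c*Q)^(n-1) * (1 / max 1 |(z:ℝ)|)^e := by
          rw [mul_pow, show n - 1 = j + e by lia, pow_add]; ring
  calc (W.card : ℝ) ≤ S.card := by exact_mod_cast hcard
    _ ≤ _ := hS
    _ = (3*c*Q)^(n-1) * ∑ z ∈ Finset.Icc (-B) B, (1 / max 1 |(z:ℝ)|)^e := by rw [Finset.mul_sum]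
    _ ≤ (3*c*Q)^(n-1) * (C * Real.log Q ^ deltaExp n) := by
        have := hCQ Q hQ
        gcongr
    _ = _ := by rw [mul_pow]; ring

open Classical in
lemma red_count (n : ℕ) (hn : 2 ≤ n) :
    ∃ C : ℝ, 0 < C ∧ ∀ Q : ℝ, 2 ≤ Q →
      ((Finset.univ.filter fun v : Fin n → Finset.Icc (-⌊Q⌋) ⌊Q⌋ =>
        ¬ Irreducible (pol n (fun i => (v i : ℤ)) : Polynomial ℤ)).card : ℝ)
        ≤ C * Q ^ (n-1) * Real.log Q ^ deltaExp n := by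
  have H : ∀ j : Fin (n/2), 2 * ((j:ℕ)+1) ≤ n := fun j => by have := j.2; lia
  choose C hC hCQ using fun j : Fin (n/2) => red_count_j n j (H j)
  refine ⟨1 + ∑ j, C j, ?_, fun Q hQ => ?_⟩
  · have := Finset.sum_nonneg (fun j (_ : j ∈ Finset.univ) => (hC j).le)
    linarith
  set A : Fin (n/2) → Finset (Fin n → Finset.Icc (-⌊Q⌋) ⌊Q⌋) := fun j =>
    (Finset.univ.filter fun v : Fin n → Finset.Icc (-⌊Q⌋) ⌊Q⌋ =>
        ∃ f g : Polynomial ℤ, f.Monic ∧ g.Monic ∧ f * g = pol n (fun i => (v i : ℤ)) ∧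
          g.natDegree = j + 1) with hA
  have hsub : (Finset.univ.filter fun v : Fin n → Finset.Icc (-⌊Q⌋) ⌊Q⌋ =>
        ¬ Irreducible (pol n (fun i => (v i : ℤ)) : Polynomial ℤ)) ⊆ Finset.univ.biUnion A := by
    intro v hv
    have hv := (Finset.mem_filter.1 hv).2
    rw [(pol_monic n _).irreducible_iff_natDegree'] at hv
    have h1 : pol n (fun i => (v i : ℤ)) ≠ 1 := by
      intro h
      have := congrArg Polynomial.natDegree h
      rw [pol_natDegree, Polynomial.natDegree_one] at this
      lia
    simp only [not_and, not_forall] at hv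
    obtain ⟨f, g, hf, hg, hfg, hd⟩ := hv h1
    rw [not_not, Finset.mem_Ioc, pol_natDegree] at hd
    refine Finset.mem_biUnion.2 ⟨⟨g.natDegree - 1, by lia⟩, Finset.mem_univ _, ?_⟩
    refine Finset.mem_filter.2 ⟨Finset.mem_univ _, f, g, hf, hg, hfg, ?_⟩
    simp only; lia
  have hL : 0 ≤ Q ^ (n-1) * Real.log Q ^ deltaExp n := by
    have := Real.log_nonneg (show 1 ≤ Q by linarith)
    positivity
  calc _ ≤ ((Finset.univ.biUnion A).card : ℝ) := by exact_mod_cast Finset.card_le_card hsub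
    _ ≤ ∑ j, ((A j).card : ℝ) := by exact_mod_cast Finset.card_biUnion_le
    _ ≤ ∑ j, C j * Q ^ (n-1) * Real.log Q ^ deltaExp n := Finset.sum_le_sum fun j _ => hCQ j Q hQ
    _ = (∑ j, C j) * (Q ^ (n-1) * Real.log Q ^ deltaExp n) := by
        rw [Finset.sum_mul]; exact Finset.sum_congr rfl fun _ _ => by ring
    _ ≤ (1 + ∑ j, C j) * (Q ^ (n-1) * Real.log Q ^ deltaExp n) := by gcongr; linarith
    _ = _ := by ring

lemma irr_minpoly (p : Polynomial ℤ) (hp : p.Monic) (hi : Irreducible p) (α : ℝ)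
    (h : Polynomial.aeval α p = 0) : p.map (algebraMap ℤ ℚ) = minpoly ℚ α := by
  refine minpoly.eq_of_irreducible_of_monic
    ((hp.irreducible_iff_irreducible_map_fraction_map).1 hi) ?_ (hp.map _)
  rw [Polynomial.aeval_map_algebraMap]; exact h

lemma irr_isMin (p : Polynomial ℤ) (hp : p.Monic) (hi : Irreducible p) (α : ℝ)
    (h : Polynomial.aeval α p = 0) : IsMinIntPoly α p := by
  refine ⟨hp.ne_zero, h, ?_, Polynomial.isPrimitive_iff_content_eq_one.1 hp.isPrimitive, ?_⟩
  · rw [hp.leadingCoeff]; norm_num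
  · intro q hq hqa
    have hinj : Function.Injective (algebraMap ℤ ℚ) := (algebraMap ℤ ℚ).injective_int
    have h1 := minpoly.degree_le_of_ne_zero ℚ α (p := q.map (algebraMap ℤ ℚ))
      ((Polynomial.map_ne_zero_iff hinj).2 hq) (by rw [Polynomial.aeval_map_algebraMap]; exact hqa)
    rw [← irr_minpoly p hp hi α h] at h1
    have h2 := Polynomial.natDegree_le_natDegree h1
    rwa [Polynomial.natDegree_map_eq_of_injective hinj,
      Polynomial.natDegree_map_eq_of_injective hinj] at h2

lemma isMin_irr (p : Polynomial ℤ) (hp : p.Monic) (hd : p.natDegree ≠ 0) (α : ℝ)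
    (h : IsMinIntPoly α p) : Irreducible p := by
  rw [hp.irreducible_iff_natDegree']
  refine ⟨fun h1 => hd (by rw [h1, Polynomial.natDegree_one]), ?_⟩
  intro f g hf hg hfg hm
  rw [Finset.mem_Ioc] at hm
  have hdeg := hf.natDegree_mul hg
  rw [hfg] at hdeg
  have h0 := h.2.1
  rw [← hfg, map_mul, mul_eq_zero] at h0
  rcases h0 with h0 | h0
  · have := h.2.2.2.2 f hf.ne_zero h0; lia
  · have := h.2.2.2.2 g hg.ne_zero h0; lia

lemma mem_roots_pol (n : ℕ) (v : Fin n → ℤ) (α : ℝ) :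
    α ∈ (pol n (fun i => ((v i : ℤ) : ℝ))).roots.toFinset ↔ Polynomial.aeval α (pol n v) = 0 := by
  rw [Multiset.mem_toFinset, Polynomial.mem_roots (pol_monic n _).ne_zero, Polynomial.IsRoot,
    Polynomial.aeval_def, Polynomial.eval₂_eq_eval_map, pol_map]
  rfl

open Classical in
lemma omega_eq (n : ℕ) (hn : 2 ≤ n) (Q : ℝ) (hQ : 1 ≤ Q) (I : Set ℝ) :
    OmegaCount n Q I = ∑ v ∈ Finset.univ.filter (fun v : Fin n → Finset.Icc (-⌊Q⌋) ⌊Q⌋ =>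
      Irreducible (pol n (fun i => (v i : ℤ)) : Polynomial ℤ)), nrt I n (fun i => ((v i : ℤ) : ℝ)) := by
  unfold nrt
  rw [← Finset.card_biUnion, OmegaCount, ← Set.ncard_coe_finset]
  · congr 1
    ext α
    simp only [Set.mem_ofPred_eq, Finset.coe_biUnion, Set.mem_iUnion, Finset.mem_coe,
      Finset.mem_filter, Finset.mem_univ, true_and, exists_prop]
    constructor
    · rintro ⟨hα, p, hmin, hp, hd, hco⟩
      have hmem : ∀ i, p.coeff i ∈ Finset.Icc (-⌊Q⌋) ⌊Q⌋ := by
        intro i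
        have := hco i
        rw [abs_le] at this
        rw [Finset.mem_Icc, Int.le_floor]
        refine ⟨?_, this.2⟩
        rw [neg_le, Int.le_floor]; push_cast; linarith
      have hpp := pol_of_monic n p hp hd
      refine ⟨fun i => ⟨p.coeff i, hmem i⟩, ?_, ?_, hα⟩
      · simp only [hpp]
        exact isMin_irr p hp (by lia) α hmin
      · rw [mem_roots_pol n (fun i : Fin n => p.coeff i), hpp]
        exact hmin.2.1
    · rintro ⟨v, hi, hr, hα⟩
      rw [mem_roots_pol n (fun i : Fin n => (v i : ℤ))] at hr
      refine ⟨hα, _, irr_isMin _ (pol_monic n _) hi α hr, pol_monic n _, pol_natDegree n _, ?_⟩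
      intro i
      rcases lt_trichotomy i n with h | h | h
      · have := pol_coeff n (fun i => (v i : ℤ)) ⟨i, h⟩
        simp only at this
        rw [this]
        have h2 := Finset.mem_Icc.1 (v ⟨i, h⟩).2
        have h3 : (|((v ⟨i, h⟩ : ℤ))| : ℤ) ≤ ⌊Q⌋ := abs_le.2 h2
        have := Int.le_floor.1 h3
        simpa using this
      · have : (pol n (fun i => (v i : ℤ))).coeff i = 1 := by
          have h1 := pol_monic n (fun i => (v i : ℤ))
          rw [Polynomial.Monic, Polynomial.leadingCoeff, pol_natDegree] at h1
          rw [h, h1]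
        rw [this]; norm_num; linarith
      · rw [Polynomial.coeff_eq_zero_of_natDegree_lt (by rw [pol_natDegree]; exact h)]
        simp; linarith
  · intro v hv w hw hvw
    rw [Finset.coe_filter] at hv hw
    have hv := hv.2
    have hw := hw.2
    refine Finset.disjoint_left.2 fun α h1 h2 => hvw ?_
    have h1 := (mem_roots_pol n (fun i : Fin n => (v i : ℤ)) α).1 (Finset.mem_filter.1 h1).1
    have h2 := (mem_roots_pol n (fun i : Fin n => (w i : ℤ)) α).1 (Finset.mem_filter.1 h2).1
    have e := (irr_minpoly _ (pol_monic n _) hv α h1).trans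
      (irr_minpoly _ (pol_monic n _) hw α h2).symm
    have e := Polynomial.map_injective _ (algebraMap ℤ ℚ).injective_int e
    ext i
    have := congrArg (fun p => Polynomial.coeff p i) e
    simpa [pol_coeff] using this

theorem omega_count_asymptotic (n : ℕ) (hn : 2 ≤ n) :
    ∃ C : ℝ, 0 < C ∧ ∀ I : Set ℝ, I.OrdConnected → ∀ Q : ℝ, 2 ≤ Q →
      |(OmegaCount n Q I : ℝ) - Q ^ n * ∫ t in I, omegaFn n Q⁻¹ t| ≤
        C * Q ^ (n - 1) * (Real.log Q) ^ deltaExp n := by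
  classical
  obtain ⟨C, hC, hCQ⟩ := red_count n hn
  refine ⟨n * C + 2 * (n * 3 ^ (n+1) * 3 ^ (n-1)), by positivity, fun I hI Q hQ => ?_⟩
  have hL := lattice_integral n Q (by linarith) I hI
  have hM : Q ^ n * ∫ t in I, omegaFn n Q⁻¹ t = ∫ p, (nrt I n p : ℝ) ∂(Measure.pi fun _ : Fin n => volume.restrict (Set.Icc (-Q) Q)) := by
    obtain ⟨m, rfl⟩ : ∃ m, n = m + 1 := ⟨n - 1, by lia⟩
    exact main_integral m Q (by linarith) I hI
  rw [hM, omega_eq n hn Q (by linarith) I]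
  rw [← Finset.sum_filter_add_sum_filter_not Finset.univ
    (fun v : Fin n → Finset.Icc (-⌊Q⌋) ⌊Q⌋ =>
      Irreducible (pol n (fun i => (v i : ℤ)) : Polynomial ℤ))] at hL
  push_cast
  have hR : ∑ v ∈ Finset.univ.filter (fun v : Fin n → Finset.Icc (-⌊Q⌋) ⌊Q⌋ =>
      ¬ Irreducible (pol n (fun i => (v i : ℤ)) : Polynomial ℤ)),
      (nrt I n (fun i => ((v i : ℤ) : ℝ)) : ℝ) ≤ n * (C * Q ^ (n-1) * Real.log Q ^ deltaExp n) := by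
    refine (Finset.sum_le_card_nsmul _ _ (n:ℝ) fun v _ => ?_).trans ?_
    · exact_mod_cast nrt_le I n _
    · rw [nsmul_eq_mul, mul_comm]
      exact mul_le_mul_of_nonneg_left (hCQ Q hQ) (Nat.cast_nonneg _)
  have hR0 : 0 ≤ ∑ v ∈ Finset.univ.filter (fun v : Fin n → Finset.Icc (-⌊Q⌋) ⌊Q⌋ =>
      ¬ Irreducible (pol n (fun i => (v i : ℤ)) : Polynomial ℤ)),
      (nrt I n (fun i => ((v i : ℤ) : ℝ)) : ℝ) := Finset.sum_nonneg fun _ _ => Nat.cast_nonneg _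
  have hlog : 1 ≤ 2 * Real.log Q ^ deltaExp n := by
    have := log_half Q hQ
    unfold deltaExp
    split_ifs
    · rw [pow_one]; linarith
    · norm_num
  have hE : (n:ℝ) * 3^(n+1) * (3*Q)^(n-1) ≤
      2 * (n * 3 ^ (n+1) * 3 ^ (n-1)) * Q ^ (n-1) * Real.log Q ^ deltaExp n := by
    have hQ0 : 0 ≤ Q := by linarith
    have h0 : 0 ≤ (n:ℝ) * 3 ^ (n+1) * 3 ^ (n-1) * Q ^ (n-1) := by positivity
    rw [mul_pow]
    nlinarith [mul_le_mul_of_nonneg_left hlog h0]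
  rw [abs_le] at hL ⊢
  have hfin : (n * C + 2 * (n * 3 ^ (n+1) * 3 ^ (n-1))) * Q ^ (n - 1) * Real.log Q ^ deltaExp n =
    n * (C * Q ^ (n-1) * Real.log Q ^ deltaExp n) +
    2 * (n * 3 ^ (n+1) * 3 ^ (n-1)) * Q ^ (n-1) * Real.log Q ^ deltaExp n := by ring
  rw [hfin]
  constructor <;> linarith [hL.1, hL.2]
end

section
/- There is an absolute constant C > 0 such that for every interval I ⊆ ℝ and every Q ≥ 2, the number Ω_2(Q,I) of real quadratic algebraic integers in I of height at most Q satisfies |Ω_2(Q,I) − Q^2 ∫_I ω_2(Q^{−1},t) dt + 2Q ∫_{I∩[−Q,Q]} dt/max(1,|t|)| ≤ C·Q. -/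
open MeasureTheory Filter

open scoped Interval

def Hf (Q : ℝ) (h : ℝ → ℝ) (M : ℝ) : Prop :=
  IntervalIntegrable h volume 0 Q ∧
    |(∑ i ∈ Finset.range ⌊Q⌋₊, h ((i : ℝ) + 1)) - ∫ x in (0:ℝ)..Q, h x| ≤ M

lemma Hf.add {Q : ℝ} {h g : ℝ → ℝ} {M M' : ℝ} (a : Hf Q h M) (b : Hf Q g M') :
    Hf Q (fun x => h x + g x) (M + M') := by
  refine ⟨a.1.add b.1, ?_⟩
  rw [Finset.sum_add_distrib, intervalIntegral.integral_add a.1 b.1]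
  have := abs_le.1 a.2
  have := abs_le.1 b.2
  rw [abs_le]; constructor <;> linarith

lemma Hf.sub {Q : ℝ} {h g : ℝ → ℝ} {M M' : ℝ} (a : Hf Q h M) (b : Hf Q g M') :
    Hf Q (fun x => h x - g x) (M + M') := by
  refine ⟨a.1.sub b.1, ?_⟩
  rw [Finset.sum_sub_distrib, intervalIntegral.integral_sub a.1 b.1]
  have := abs_le.1 a.2
  have := abs_le.1 b.2
  rw [abs_le]; constructor <;> linarith

lemma Hf.const {Q : ℝ} (hQ : 2 ≤ Q) {M : ℝ} (hM : 0 ≤ M) : Hf Q (fun _ => M) M := by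
  refine ⟨by simp, ?_⟩
  simp only [Finset.sum_const, Finset.card_range, nsmul_eq_mul, intervalIntegral.integral_const,
    sub_zero, smul_eq_mul]
  have h1 := Nat.floor_le (show 0 ≤ Q by linarith)
  have h2 := Nat.lt_floor_add_one Q
  rw [abs_le]; constructor <;> nlinarith

lemma Hf.anti {Q : ℝ} (hQ : 2 ≤ Q) {h : ℝ → ℝ} {M : ℝ} (hh : AntitoneOn h (Set.Icc 0 Q))
    (h0 : ∀ x ∈ Set.Icc 0 Q, 0 ≤ h x) (h1 : ∀ x ∈ Set.Icc 0 Q, h x ≤ M) : Hf Q h M := by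
  have hQ0 : 0 ≤ Q := by linarith
  have hN := Nat.floor_le hQ0
  have hN2 := Nat.lt_floor_add_one Q
  set N := ⌊Q⌋₊ with hNd
  have hN0 : (0:ℝ) ≤ N := Nat.cast_nonneg _
  have hi : IntervalIntegrable h volume 0 Q := by
    apply AntitoneOn.intervalIntegrable
    rwa [Set.uIcc_of_le hQ0]
  have hi1 : IntervalIntegrable h volume 0 N := hi.mono_set (by
    rw [Set.uIcc_of_le hQ0, Set.uIcc_of_le hN0]; exact Set.Icc_subset_Icc_right hN)
  have hi2 : IntervalIntegrable h volume N Q := hi.mono_set (by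
    rw [Set.uIcc_of_le hQ0, Set.uIcc_of_le hN]; exact Set.Icc_subset_Icc_left hN0)
  refine ⟨hi, ?_⟩
  rw [← hNd, ← intervalIntegral.integral_add_adjacent_intervals hi1 hi2]
  have hh' : AntitoneOn h (Set.Icc (0:ℝ) (0 + (N:ℝ))) := by
    rw [zero_add]; exact hh.mono (Set.Icc_subset_Icc_right hN)
  have e1 := hh'.sum_le_integral
  have e2 := hh'.integral_le_sum
  simp only [zero_add] at e1 e2
  have e3 : ∑ i ∈ Finset.range N, h (i:ℝ) = ∑ i ∈ Finset.range N, h ((i:ℝ)+1) + h 0 - h N := by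
    have := Finset.sum_range_succ (fun i : ℕ => h (i:ℝ)) N
    rw [Finset.sum_range_succ'] at this
    push_cast at this
    linarith
  have a0 := h1 0 ⟨le_rfl, hQ0⟩
  have a1 := h0 N ⟨hN0, hN⟩
  have e4 : 0 ≤ ∫ x in (N:ℝ)..Q, h x :=
    intervalIntegral.integral_nonneg hN (fun u hu => h0 u ⟨hN0.trans hu.1, hu.2⟩)
  have e5 : ∫ x in (N:ℝ)..Q, h x ≤ ∫ x in (N:ℝ)..Q, h N :=
    intervalIntegral.integral_mono_on hN hi2 (by simp)
      (fun u hu => hh ⟨hN0, hN⟩ ⟨hN0.trans hu.1, hu.2⟩ hu.1)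
  simp only [intervalIntegral.integral_const, smul_eq_mul] at e5
  push_cast at e1
  rw [abs_le]; constructor <;> nlinarith

lemma Hf.mono {Q : ℝ} (hQ : 2 ≤ Q) {h : ℝ → ℝ} {M : ℝ} (hM : 0 ≤ M)
    (hh : MonotoneOn h (Set.Icc 0 Q))
    (h0 : ∀ x ∈ Set.Icc 0 Q, 0 ≤ h x) (h1 : ∀ x ∈ Set.Icc 0 Q, h x ≤ M) : Hf Q h (2 * M) := by
  have a : Hf Q (fun x => M - h x) M := Hf.anti hQ
    (fun x hx y hy hxy => by have := hh hx hy hxy; linarith)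
    (fun x hx => by have := h1 x hx; linarith) (fun x hx => by have := h0 x hx; linarith)
  have := (Hf.const hQ hM).sub a
  simp only [sub_sub_cancel] at this
  rwa [two_mul]

lemma sum_Icc_symm (h : ℝ → ℝ) (N : ℕ) : ∑ k ∈ Finset.Icc (-(N:ℤ)) N, h (k:ℝ) =
    h 0 + ∑ i ∈ Finset.range N, h ((i:ℝ)+1) + ∑ i ∈ Finset.range N, h (-((i:ℝ)+1)) := by
  induction N with
  | zero => simp
  | succ N ih =>
    have : Finset.Icc (-((N+1:ℕ):ℤ)) ((N+1:ℕ):ℤ) =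
        insert (-((N:ℤ)+1)) (insert ((N:ℤ)+1) (Finset.Icc (-(N:ℤ)) N)) := by
      ext x; simp only [Finset.mem_Icc, Finset.mem_insert]; push_cast; omega
    rw [this, Finset.sum_insert, Finset.sum_insert, ih, Finset.sum_range_succ,
      Finset.sum_range_succ]
    · push_cast; ring
    · simp
    · simp only [Finset.mem_Icc, Finset.mem_insert]; omega

lemma full_of_half {Q : ℝ} {h : ℝ → ℝ} {M0 M1 M2 : ℝ} (h0 : |h 0| ≤ M0) (a : Hf Q h M1)
    (b : Hf Q (fun x => h (-x)) M2) :
    |∑ k ∈ Finset.Icc (-(⌊Q⌋₊:ℤ)) ⌊Q⌋₊, h (k:ℝ) - ∫ x in (-Q)..Q, h x| ≤ M0 + M1 + M2 := by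
  have hi : IntervalIntegrable h volume (-Q) 0 := by
    have := b.1.symm
    rw [← neg_zero, IntervalIntegrable.iff_comp_neg]
    simpa using this
  rw [sum_Icc_symm, ← intervalIntegral.integral_add_adjacent_intervals hi a.1]
  have e := intervalIntegral.integral_comp_neg (a := 0) (b := Q) h
  rw [neg_zero] at e
  have a2 := abs_le.1 a.2
  have b2 := abs_le.1 b.2
  rw [e] at b2
  have := abs_le.1 h0
  rw [abs_le]; constructor <;> linarith

lemma ordconn_half {Q : ℝ} (hQ : 2 ≤ Q) {K : Set ℝ} (hK : K.OrdConnected) {φ : ℝ → ℝ}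
    (hh : AntitoneOn φ (Set.Icc 0 Q))
    (h0 : ∀ x ∈ Set.Icc 0 Q, 0 ≤ φ x) (h1 : ∀ x ∈ Set.Icc 0 Q, φ x ≤ 1) :
    Hf Q (K.indicator φ) 2 := by
  classical
  have key : ∀ D : Set ℝ, IsLowerSet D → Hf Q (D.indicator φ) 1 := by
    intro D hD
    apply Hf.anti hQ
    · intro x hx y hy hxy
      by_cases hyD : y ∈ D
      · rw [Set.indicator_of_mem hyD, Set.indicator_of_mem (hD hxy hyD)]; exact hh hx hy hxy
      · rw [Set.indicator_of_notMem hyD]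
        by_cases hxD : x ∈ D
        · rw [Set.indicator_of_mem hxD]; exact h0 x hx
        · rw [Set.indicator_of_notMem hxD]
    · intro x hx
      by_cases hxD : x ∈ D
      · rw [Set.indicator_of_mem hxD]; exact h0 x hx
      · rw [Set.indicator_of_notMem hxD]
    · intro x hx
      by_cases hxD : x ∈ D
      · rw [Set.indicator_of_mem hxD]; exact h1 x hx
      · rw [Set.indicator_of_notMem hxD]; norm_num
  have a := key {x | ∃ y ∈ K, x ≤ y} (fun x y hxy ⟨z, hz, hz2⟩ => ⟨z, hz, hxy.trans hz2⟩)
  have b := key {x | (∃ y ∈ K, x ≤ y) ∧ x ∉ K} (by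
    rintro x y hxy ⟨⟨z, hz, hz2⟩, hx⟩
    refine ⟨⟨z, hz, hxy.trans hz2⟩, fun hy => hx (hK.out hy hz ⟨hxy, hz2⟩)⟩)
  have c := a.sub b
  have : (fun x => ({x | ∃ y ∈ K, x ≤ y} : Set ℝ).indicator φ x -
      ({x | (∃ y ∈ K, x ≤ y) ∧ x ∉ K} : Set ℝ).indicator φ x) = K.indicator φ := by
    funext x
    by_cases hx : x ∈ K
    · have : ∃ y ∈ K, x ≤ y := ⟨x, hx, le_rfl⟩
      simp [Set.indicator, hx, this]
    · simp [Set.indicator, hx]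
  rw [this] at c
  norm_num at c
  exact c

def ng (K : Set ℝ) : Set ℝ := {x | -x ∈ K}

lemma ordconn_neg {K : Set ℝ} (hK : K.OrdConnected) : (ng K).OrdConnected :=
  ⟨fun x hx y hy z hz =>
    hK.out hy hx (⟨by linarith [hz.2], by linarith [hz.1]⟩ : -z ∈ Set.Icc (-y) (-x))⟩

lemma ordconn_full {Q : ℝ} (hQ : 2 ≤ Q) {K : Set ℝ} (hK : K.OrdConnected) {φ : ℝ → ℝ}
    (hh : AntitoneOn φ (Set.Icc 0 Q)) (he : ∀ x, φ (-x) = φ x)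
    (h0 : ∀ x ∈ Set.Icc 0 Q, 0 ≤ φ x) (h1 : ∀ x ∈ Set.Icc 0 Q, φ x ≤ 1) :
    |∑ k ∈ Finset.Icc (-(⌊Q⌋₊:ℤ)) ⌊Q⌋₊, K.indicator φ (k:ℝ) - ∫ x in (-Q)..Q, K.indicator φ x|
      ≤ 5 := by
  have a := ordconn_half hQ hK hh h0 h1
  have b := ordconn_half hQ (ordconn_neg hK) hh h0 h1
  have e : (ng K).indicator φ = fun x => K.indicator φ (-x) := by
    funext x
    simp only [Set.indicator, he]; rfl
  rw [e] at b
  have c : |K.indicator φ 0| ≤ 1 := by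
    have m : (0:ℝ) ∈ Set.Icc 0 Q := ⟨le_rfl, by linarith⟩
    by_cases h : (0:ℝ) ∈ K
    · rw [Set.indicator_of_mem h, abs_of_nonneg (h0 0 m)]; exact h1 0 m
    · rw [Set.indicator_of_notMem h]; norm_num
  have := full_of_half c a b
  linarith

noncomputable def rt (b c : ℝ) : ℝ := (-b + √(b ^ 2 - 4 * c)) / 2

def AA (Q : ℝ) (I : Set ℝ) (b : ℝ) : Set ℝ := {c | |c| ≤ Q ∧ 0 < b ^ 2 - 4 * c ∧ rt b c ∈ I}

lemma rt_pos {b c : ℝ} (h : 0 < b ^ 2 - 4 * c) : 0 < 2 * rt b c + b := by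
  have := Real.sqrt_pos.2 h
  unfold rt; linarith

lemma rt_eq {b c : ℝ} (h : 0 < b ^ 2 - 4 * c) : rt b c ^ 2 + b * rt b c + c = 0 := by
  have := Real.sq_sqrt h.le
  unfold rt; linarith

lemma le_rt {b c t : ℝ} (h : t ^ 2 + b * t + c ≤ 0) : t ≤ rt b c := by
  have : 2 * t + b ≤ √(b ^ 2 - 4 * c) := Real.le_sqrt_of_sq_le (by nlinarith)
  unfold rt; linarith

lemma rt_unique {b c t : ℝ} (h : t ^ 2 + b * t + c = 0) (h2 : 0 < 2 * t + b) : rt b c = t := by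
  have : √(b ^ 2 - 4 * c) = 2 * t + b := by
    rw [show b ^ 2 - 4 * c = (2 * t + b) ^ 2 by linarith]
    exact Real.sqrt_sq h2.le
  unfold rt; rw [this]; ring

lemma AA_ord {Q : ℝ} {I : Set ℝ} (hI : I.OrdConnected) (b : ℝ) : (AA Q I b).OrdConnected := by
  refine ⟨fun x hx y hy z hz => ?_⟩
  obtain ⟨x1, x2, x3⟩ := hx
  obtain ⟨y1, y2, y3⟩ := hy
  have hz0 : 0 < b ^ 2 - 4 * z := by linarith [hz.2]
  refine ⟨abs_le.2 ⟨(abs_le.1 x1).1.trans hz.1, hz.2.trans (abs_le.1 y1).2⟩, hz0,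
    hI.out y3 x3 ⟨?_, ?_⟩⟩
  · apply le_rt; have := rt_eq y2; linarith [hz.2]
  · apply le_rt; have := rt_eq hz0; linarith [hz.1]

lemma AA_sub {Q : ℝ} {I : Set ℝ} {b : ℝ} : AA Q I b ⊆ Set.Icc (-Q) Q := fun _ h => abs_le.1 h.1

lemma AA_meas {Q : ℝ} {I : Set ℝ} (hI : I.OrdConnected) (b : ℝ) : MeasurableSet (AA Q I b) :=
  (AA_ord hI b).measurableSet

lemma vol_fin {Q : ℝ} {s : Set ℝ} (h : s ⊆ Set.Icc (-Q) Q) : volume s ≠ ⊤ :=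
  ((measure_mono h).trans_lt (by simp)).ne

lemma vol_le {Q : ℝ} (hQ : 2 ≤ Q) {s : Set ℝ} (h : s ⊆ Set.Icc (-Q) Q) :
    volume.real s ≤ 2 * Q := by
  have := measureReal_mono (μ := volume) h (by simp)
  rw [Real.volume_real_Icc_of_le (by linarith)] at this
  linarith

lemma AA_upper {Q : ℝ} {J : Set ℝ} (hJ : IsUpperSet J) {b b' c : ℝ} (hc : c ∈ AA Q J b)
    (h0 : 0 < b' ^ 2 - 4 * c) (h : (b' - b) * rt b c ≤ 0) : c ∈ AA Q J b' := by
  refine ⟨hc.1, h0, hJ (le_rt ?_) hc.2.2⟩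
  have := rt_eq hc.2.1
  linarith

noncomputable def vA (Q : ℝ) (I : Set ℝ) (b : ℝ) : ℝ := volume.real (AA Q I b)

lemma vA_split {Q : ℝ} {I : Set ℝ} (b : ℝ) :
    vA Q I b = volume.real (AA Q I b ∩ Set.Ioi 0) + volume.real (AA Q I b ∩ Set.Iio 0) := by
  have h1 := measureReal_inter_add_sdiff₀ (μ := volume) (s := AA Q I b)
    (measurableSet_Ioi (a := (0:ℝ))).nullMeasurableSet (vol_fin AA_sub)
  rw [vA, ← h1]
  congr 1
  apply measureReal_congr
  have : (Set.Iic 0 : Set ℝ) =ᵐ[volume] Set.Iio 0 := Iio_ae_eq_Iic.symm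
  have e : AA Q I b \ Set.Ioi 0 = AA Q I b ∩ Set.Iic 0 := by
    ext x; simp
  rw [e]
  exact (ae_eq_refl _).inter this

/-- negative constant term: nonneg root -/
lemma rt_neg {b c : ℝ} (h : 0 < b ^ 2 - 4 * c) (hc : c < 0) : 0 ≤ rt b c := by
  have h1 := rt_eq h
  have h2 := rt_pos h
  by_contra h3
  push Not at h3
  nlinarith

lemma rt_negb {b c : ℝ} (h : 0 < b ^ 2 - 4 * c) (hc : b ≤ 0) : 0 ≤ rt b c := by
  have h2 := rt_pos h
  linarith

lemma rt_pp {b c : ℝ} (h : 0 < b ^ 2 - 4 * c) (hb : 0 ≤ b) (hc : 0 < c) : rt b c ≤ 0 := by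
  have h1 := rt_eq h
  by_contra h3
  push Not at h3
  nlinarith

lemma rmono {Q : ℝ} {s t : Set ℝ} (h : s ⊆ t) (h2 : t ⊆ Set.Icc (-Q) Q) :
    volume.real s ≤ volume.real t := measureReal_mono h (vol_fin h2)

lemma sub1 {Q : ℝ} {I : Set ℝ} {b : ℝ} {s : Set ℝ} : AA Q I b ∩ s ⊆ Set.Icc (-Q) Q :=
  Set.inter_subset_left.trans AA_sub

lemma vA_half_upper {Q : ℝ} (hQ : 2 ≤ Q) {J : Set ℝ} (hJ : IsUpperSet J) :
    Hf Q (vA Q J) (6 * Q) := by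
  have a : Hf Q (fun b => volume.real (AA Q J b ∩ Set.Ioi 0)) (2 * (2 * Q)) := by
    refine Hf.mono hQ (by linarith) ?_ (fun _ _ => measureReal_nonneg) (fun _ _ => vol_le hQ sub1)
    intro b hb b' hb' hbb
    refine rmono ?_ sub1
    rintro c ⟨hc, hc0⟩
    refine ⟨AA_upper hJ hc ?_ ?_, hc0⟩
    · have := hc.2.1; nlinarith [hb.1]
    · have := rt_pp hc.2.1 hb.1 hc0
      nlinarith
  have b : Hf Q (fun b => volume.real (AA Q J b ∩ Set.Iio 0)) (2 * Q) := by
    refine Hf.anti hQ ?_ (fun _ _ => measureReal_nonneg) (fun _ _ => vol_le hQ sub1)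
    intro b hb b' hb' hbb
    refine rmono ?_ sub1
    rintro c ⟨hc, hc0⟩
    have hc0' : c < 0 := hc0
    refine ⟨AA_upper hJ hc ?_ ?_, hc0⟩
    · nlinarith
    · have := rt_neg hc.2.1 hc0
      nlinarith
  have := a.add b
  rw [show 2 * (2 * Q) + 2 * Q = 6 * Q by ring] at this
  simpa only [← vA_split] using this

lemma vA_half_upper' {Q : ℝ} (hQ : 2 ≤ Q) {J : Set ℝ} (hJ : IsUpperSet J) :
    Hf Q (fun b => vA Q J (-b)) (8 * Q) := by
  have key : ∀ b b' c : ℝ, 0 ≤ b → b ≤ b' → c ∈ AA Q J (-b) → c ≠ 0 → c ∈ AA Q J (-b') := by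
    intro b b' c hb hbb hc hc0
    refine AA_upper hJ hc ?_ ?_
    · have := hc.2.1; nlinarith
    · have := rt_negb hc.2.1 (by linarith)
      nlinarith
  have a : Hf Q (fun b => volume.real (AA Q J (-b) ∩ Set.Ioi 0)) (2 * (2 * Q)) := by
    refine Hf.mono hQ (by linarith) ?_ (fun _ _ => measureReal_nonneg) (fun _ _ => vol_le hQ sub1)
    intro b hb b' hb' hbb
    refine rmono ?_ sub1
    rintro c ⟨hc, hc0⟩
    exact ⟨key b b' c hb.1 hbb hc (ne_of_gt hc0), hc0⟩
  have b : Hf Q (fun b => volume.real (AA Q J (-b) ∩ Set.Iio 0)) (2 * (2 * Q)) := by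
    refine Hf.mono hQ (by linarith) ?_ (fun _ _ => measureReal_nonneg) (fun _ _ => vol_le hQ sub1)
    intro b hb b' hb' hbb
    refine rmono ?_ sub1
    rintro c ⟨hc, hc0⟩
    exact ⟨key b b' c hb.1 hbb hc (ne_of_lt hc0), hc0⟩
  have := a.add b
  rw [show 2 * (2 * Q) + 2 * (2 * Q) = 8 * Q by ring] at this
  simpa only [← vA_split] using this

lemma vA_sub {Q : ℝ} {I : Set ℝ} (hI : I.OrdConnected) : ∃ J1 J2 : Set ℝ, IsUpperSet J1 ∧
    IsUpperSet J2 ∧ ∀ b, vA Q I b = vA Q J1 b - vA Q J2 b := by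
  have u2 : IsUpperSet {x | (∃ y ∈ I, y ≤ x) ∧ x ∉ I} := by
    rintro x y hxy ⟨⟨z, hz, hz2⟩, hx⟩
    refine ⟨⟨z, hz, hz2.trans hxy⟩, fun hy => hx (hI.out hz hy ⟨hz2, hxy⟩)⟩
  refine ⟨{x | ∃ y ∈ I, y ≤ x}, {x | (∃ y ∈ I, y ≤ x) ∧ x ∉ I},
    fun x y hxy ⟨z, hz, hz2⟩ => ⟨z, hz, hz2.trans hxy⟩, u2, fun b => ?_⟩
  unfold vA
  rw [← measureReal_sdiff _ (AA_meas u2.ordConnected b) (vol_fin AA_sub)]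
  · congr 1
    ext c
    constructor
    · rintro ⟨h1, h2, h3⟩
      exact ⟨⟨h1, h2, _, h3, le_rfl⟩, fun h => h.2.2.2 h3⟩
    · rintro ⟨⟨h1, h2, h3⟩, h4⟩
      refine ⟨h1, h2, ?_⟩
      by_contra h5
      exact h4 ⟨h1, h2, h3, h5⟩
  · rintro c ⟨h1, h2, h3⟩
    exact ⟨h1, h2, h3.1⟩

lemma vA_full {Q : ℝ} (hQ : 2 ≤ Q) {I : Set ℝ} (hI : I.OrdConnected) :
    |∑ k ∈ Finset.Icc (-(⌊Q⌋₊:ℤ)) ⌊Q⌋₊, vA Q I (k:ℝ) - ∫ x in (-Q)..Q, vA Q I x| ≤ 30 * Q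
      ∧ IntervalIntegrable (vA Q I) volume (-Q) Q := by
  obtain ⟨J1, J2, h1, h2, h⟩ := vA_sub (Q := Q) hI
  have a := (vA_half_upper hQ h1).sub (vA_half_upper hQ h2)
  have b := (vA_half_upper' hQ h1).sub (vA_half_upper' hQ h2)
  simp only [← h] at a b
  have c : |vA Q I 0| ≤ 2 * Q := by
    rw [vA, abs_of_nonneg measureReal_nonneg]; exact vol_le hQ AA_sub
  have := full_of_half c a b
  refine ⟨by linarith, ?_⟩
  have hi : IntervalIntegrable (vA Q I) volume (-Q) 0 := by
    have := b.1.symm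
    rw [← neg_zero, IntervalIntegrable.iff_comp_neg]
    simpa using this
  exact hi.trans a.1

lemma cA_near {Q : ℝ} (hQ : 2 ≤ Q) {I : Set ℝ} (hI : I.OrdConnected) (b : ℝ) :
    |∑ k ∈ Finset.Icc (-(⌊Q⌋₊:ℤ)) ⌊Q⌋₊, (AA Q I b).indicator (fun _ => (1:ℝ)) (k:ℝ) - vA Q I b| ≤ 5 := by
  have := ordconn_full hQ (AA_ord (Q := Q) hI b) (φ := fun _ => 1) (fun _ _ _ _ _ => le_rfl) (fun _ => rfl)
    (by simp) (by simp)
  convert this using 3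
  rw [intervalIntegral.integral_of_le (by linarith), ← integral_Icc_eq_integral_Ioc,
    setIntegral_indicator (AA_meas hI b), Set.inter_eq_right.2 AA_sub]
  simp [vA]

lemma cA_total {Q : ℝ} (hQ : 2 ≤ Q) {I : Set ℝ} (hI : I.OrdConnected) :
    |∑ b ∈ Finset.Icc (-(⌊Q⌋₊:ℤ)) ⌊Q⌋₊, ∑ k ∈ Finset.Icc (-(⌊Q⌋₊:ℤ)) ⌊Q⌋₊,
      (AA Q I (b:ℝ)).indicator (fun _ => (1:ℝ)) (k:ℝ) - ∫ x in (-Q)..Q, vA Q I x| ≤ 50 * Q := by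
  have h1 := (vA_full hQ hI).1
  have h2 : |∑ b ∈ Finset.Icc (-(⌊Q⌋₊:ℤ)) ⌊Q⌋₊, (∑ k ∈ Finset.Icc (-(⌊Q⌋₊:ℤ)) ⌊Q⌋₊,
      (AA Q I (b:ℝ)).indicator (fun _ => (1:ℝ)) (k:ℝ) - vA Q I b)| ≤
      ∑ b ∈ Finset.Icc (-(⌊Q⌋₊:ℤ)) ⌊Q⌋₊, (5:ℝ) :=
    (Finset.abs_sum_le_sum_abs _ _).trans (Finset.sum_le_sum fun b _ => cA_near hQ hI b)
  rw [Finset.sum_sub_distrib, Finset.sum_const, Int.card_Icc, nsmul_eq_mul] at h2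
  have e : (((⌊Q⌋₊:ℤ) + 1 - -(⌊Q⌋₊:ℤ)).toNat : ℝ) = 2 * (⌊Q⌋₊:ℝ) + 1 := by
    rw [show ((⌊Q⌋₊:ℤ) + 1 - -(⌊Q⌋₊:ℤ)).toNat = 2 * ⌊Q⌋₊ + 1 by omega]; push_cast; ring
  rw [e] at h2
  have := Nat.floor_le (show 0 ≤ Q by linarith)
  have h1 := abs_le.1 h1
  have h2 := abs_le.1 h2
  rw [abs_le]; constructor <;> linarith

lemma omega_eq_s1 {Q : ℝ} (hQ : 2 ≤ Q) (t : ℝ) : Q ^ 2 * omegaFn 2 Q⁻¹ t =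
    ∫ b, ({b : ℝ | |b| ≤ Q ∧ |t ^ 2 + b * t| ≤ Q}).indicator (fun b => |2 * t + b|) b := by
  have hQ0 : 0 < Q := by linarith
  have e1 : omegaFn 2 Q⁻¹ t = ∫ p in {p : ℝ | |p| ≤ 1 ∧ |Q⁻¹ * t ^ 2 + p * t| ≤ 1},
      |2 * Q⁻¹ * t + p| := by
    rw [← (volume_preserving_funUnique (Fin 1) ℝ).setIntegral_preimage_emb
      (MeasurableEquiv.measurableEmbedding _)]
    unfold omegaFn Dset
    simp only [MeasurableEquiv.funUnique, Nat.add_one_sub_one]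
    simp
    rfl
  have hm : MeasurableSet {p : ℝ | |p| ≤ 1 ∧ |Q⁻¹ * t ^ 2 + p * t| ≤ 1} := by
    apply IsClosed.measurableSet
    have a1 : IsClosed {p : ℝ | |p| ≤ 1} := isClosed_le (by fun_prop) (by fun_prop)
    have a2 : IsClosed {p : ℝ | |Q⁻¹ * t ^ 2 + p * t| ≤ 1} := isClosed_le (by fun_prop) (by fun_prop)
    exact a1.inter a2
  rw [e1, ← integral_indicator hm]
  have e2 := Measure.integral_comp_div (fun p => ({p : ℝ | |p| ≤ 1 ∧ |Q⁻¹ * t ^ 2 + p * t| ≤ 1}).indicator (fun p => |2 * Q⁻¹ * t + p|) p) Q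
  rw [abs_of_pos hQ0, smul_eq_mul] at e2
  rw [pow_two, mul_assoc, ← e2, ← integral_const_mul]
  congr 1
  funext b
  have c1 : |b / Q| ≤ 1 ↔ |b| ≤ Q := by
    rw [abs_div, abs_of_pos hQ0, div_le_one hQ0]
  have c2 : |Q⁻¹ * t ^ 2 + b / Q * t| ≤ 1 ↔ |t ^ 2 + b * t| ≤ Q := by
    rw [show Q⁻¹ * t ^ 2 + b / Q * t = (t ^ 2 + b * t) / Q by field_simp, abs_div, abs_of_pos hQ0,
      div_le_one hQ0]
  have c3 : Q * |2 * Q⁻¹ * t + b / Q| = |2 * t + b| := by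
    rw [show 2 * Q⁻¹ * t + b / Q = (2 * t + b) / Q by field_simp, abs_div, abs_of_pos hQ0]
    field_simp
  simp only [Set.indicator, Set.mem_ofPred_eq, c1, c2, mul_ite, c3, mul_zero]

lemma image_pos {Q : ℝ} {I : Set ℝ} (b : ℝ) :
    (fun t : ℝ => -t ^ 2 - b * t) '' {t | t ∈ I ∧ 0 < 2 * t + b ∧ |t ^ 2 + b * t| ≤ Q} = AA Q I b := by
  ext c
  constructor
  · rintro ⟨t, ⟨h1, h2, h3⟩, rfl⟩
    refine ⟨?_, ?_, ?_⟩
    · dsimp only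
      rwa [show -t ^ 2 - b * t = -(t ^ 2 + b * t) by ring, abs_neg]
    · dsimp only; nlinarith
    · rw [rt_unique (t := t) (by ring) h2]; exact h1
  · rintro ⟨h1, h2, h3⟩
    refine ⟨rt b c, ⟨h3, rt_pos h2, ?_⟩, ?_⟩
    · rw [show rt b c ^ 2 + b * rt b c = -c by linarith [rt_eq h2], abs_neg]; exact h1
    · dsimp only; linarith [rt_eq h2]

lemma image_neg {Q : ℝ} {I : Set ℝ} (b : ℝ) :
    (fun t : ℝ => -t ^ 2 - b * t) '' {t | t ∈ I ∧ 2 * t + b < 0 ∧ |t ^ 2 + b * t| ≤ Q} =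
      AA Q (ng I) (-b) := by
  rw [← image_pos]
  ext c
  constructor
  · rintro ⟨t, ⟨h1, h2, h3⟩, rfl⟩
    refine ⟨-t, ⟨by simpa [ng] using h1, by linarith, ?_⟩, by dsimp only; ring⟩
    convert h3 using 2; ring
  · rintro ⟨t, ⟨h1, h2, h3⟩, rfl⟩
    refine ⟨-t, ⟨h1, by linarith, ?_⟩, by ring⟩
    convert h3 using 2; ring

lemma cov {s : Set ℝ} (b : ℝ) (hs : MeasurableSet s)
    (hi : Set.InjOn (fun t : ℝ => -t ^ 2 - b * t) s) :
    ∫ t in s, |2 * t + b| = volume.real ((fun t : ℝ => -t ^ 2 - b * t) '' s) := by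
  have := integral_image_eq_integral_abs_deriv_smul (f := fun t : ℝ => -t ^ 2 - b * t)
    (f' := fun t => -(2 * t) - b) hs (fun x _ => by
      have h := ((hasDerivAt_pow 2 x).neg.sub ((hasDerivAt_id x).const_mul b)).hasDerivWithinAt (s := s)
      have e : -(((2:ℕ):ℝ) * x ^ (2 - 1)) - b * 1 = -(2 * x) - b := by norm_num
      rw [e] at h
      exact h) hi (fun _ => (1:ℝ))
  simp only [smul_eq_mul, mul_one] at this
  rw [← setIntegral_one_eq_measureReal, this]
  congr 1
  funext t
  rw [← abs_neg]; congr 1; ring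

lemma meas_abs (Q b : ℝ) : MeasurableSet {t : ℝ | |t ^ 2 + b * t| ≤ Q} :=
  (isClosed_le (by fun_prop) (by fun_prop)).measurableSet

lemma inner_eq {Q : ℝ} (hQ : 2 ≤ Q) {I : Set ℝ} (hI : I.OrdConnected) (b : ℝ) :
    ∫ t, ({t : ℝ | t ∈ I ∧ |t ^ 2 + b * t| ≤ Q}).indicator (fun t => |2 * t + b|) t =
      vA Q I b + vA Q (ng I) (-b) := by
  have mI := hI.measurableSet
  have m1 : MeasurableSet {t : ℝ | t ∈ I ∧ |t ^ 2 + b * t| ≤ Q} := mI.inter (meas_abs Q b)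
  have m4 : MeasurableSet {t : ℝ | 0 < 2 * t + b} :=
    (isOpen_lt (by fun_prop) (by fun_prop)).measurableSet
  have m5 : MeasurableSet {t : ℝ | 2 * t + b < 0} :=
    (isOpen_lt (by fun_prop) (by fun_prop)).measurableSet
  have m2 : MeasurableSet {t : ℝ | t ∈ I ∧ 0 < 2 * t + b ∧ |t ^ 2 + b * t| ≤ Q} :=
    mI.inter (m4.inter (meas_abs Q b))
  have m3 : MeasurableSet {t : ℝ | t ∈ I ∧ 2 * t + b < 0 ∧ |t ^ 2 + b * t| ≤ Q} :=
    mI.inter (m5.inter (meas_abs Q b))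
  have hb : {t : ℝ | |t ^ 2 + b * t| ≤ Q} ⊆ Set.Icc (-(|b| + Q)) (|b| + Q) := by
    intro t ht
    rw [Set.mem_Icc, ← abs_le]
    by_contra h
    push Not at h
    have h1 : |t| ^ 2 ≤ Q + |b| * |t| := by
      have : |t ^ 2| ≤ |t ^ 2 + b * t| + |b * t| := by
        have := abs_sub (t ^ 2 + b * t) (b * t); simpa using this
      rw [abs_pow, abs_mul] at this
      have ht' : |t ^ 2 + b * t| ≤ Q := ht
      linarith
    have := abs_nonneg b
    nlinarith
  have hint : IntegrableOn (fun t => |2 * t + b|) {t : ℝ | |t ^ 2 + b * t| ≤ Q} :=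
    (ContinuousOn.integrableOn_compact isCompact_Icc (by fun_prop)).mono_set hb
  rw [vA, vA, ← image_pos, ← image_neg, ← cov b m2, ← cov b m3]
  · rw [← integral_indicator m2, ← integral_indicator m3, ← integral_add]
    · congr 1
      funext t
      by_cases h0 : t ∈ {t : ℝ | t ∈ I ∧ |t ^ 2 + b * t| ≤ Q}
      · rw [Set.indicator_of_mem h0]
        rcases lt_trichotomy (2 * t + b) 0 with h | h | h
        · rw [Set.indicator_of_notMem (fun h' => by linarith [h'.2.1]),
            Set.indicator_of_mem (show t ∈ {t : ℝ | t ∈ I ∧ 2 * t + b < 0 ∧ |t ^ 2 + b * t| ≤ Q} from ⟨h0.1, h, h0.2⟩), zero_add]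
        · rw [Set.indicator_of_notMem (fun h' => by linarith [h'.2.1]),
            Set.indicator_of_notMem (fun h' => by linarith [h'.2.1]), h]; simp
        · rw [Set.indicator_of_mem (show t ∈ {t : ℝ | t ∈ I ∧ 0 < 2 * t + b ∧ |t ^ 2 + b * t| ≤ Q} from ⟨h0.1, h, h0.2⟩),
            Set.indicator_of_notMem (fun h' => by linarith [h'.2.1]), add_zero]
      · rw [Set.indicator_of_notMem h0, Set.indicator_of_notMem (fun h' => h0 ⟨h'.1, h'.2.2⟩),
          Set.indicator_of_notMem (fun h' => h0 ⟨h'.1, h'.2.2⟩), add_zero]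
    · rw [integrable_indicator_iff m2]; exact hint.mono_set (fun t ht => ht.2.2)
    · rw [integrable_indicator_iff m3]; exact hint.mono_set (fun t ht => ht.2.2)
  · intro x hx y hy hxy
    have : (x - y) * (x + y + b) = 0 := by dsimp only at hxy; linarith
    rcases mul_eq_zero.1 this with h | h
    · linarith
    · exfalso; linarith [hx.2.1, hy.2.1]
  · intro x hx y hy hxy
    have : (x - y) * (x + y + b) = 0 := by dsimp only at hxy; linarith
    rcases mul_eq_zero.1 this with h | h
    · linarith
    · exfalso; linarith [hx.2.1, hy.2.1]

lemma area_eq {Q : ℝ} (hQ : 2 ≤ Q) {I : Set ℝ} (hI : I.OrdConnected) :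
    Q ^ 2 * (∫ t in I, omegaFn 2 Q⁻¹ t) =
      (∫ b in (-Q)..Q, vA Q I b) + ∫ b in (-Q)..Q, vA Q (ng I) b := by
  have mI := hI.measurableSet
  rw [← integral_const_mul, ← integral_indicator mI]
  let W : Set (ℝ × ℝ) := {x | x.1 ∈ I ∧ |x.2| ≤ Q ∧ |x.1 ^ 2 + x.2 * x.1| ≤ Q}
  let F : ℝ → ℝ → ℝ := fun t b => W.indicator (fun x => |2 * x.1 + x.2|) (t, b)
  have w1 : MeasurableSet {x : ℝ × ℝ | |x.2| ≤ Q} :=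
    (isClosed_le (by fun_prop) (by fun_prop)).measurableSet
  have w2 : MeasurableSet {x : ℝ × ℝ | |x.1 ^ 2 + x.2 * x.1| ≤ Q} :=
    (isClosed_le (by fun_prop) (by fun_prop)).measurableSet
  have mW : MeasurableSet W := (measurable_fst mI).inter (w1.inter w2)
  have hW : W ⊆ Set.Icc (-(2 * Q)) (2 * Q) ×ˢ Set.Icc (-Q) Q := by
    rintro ⟨t, b⟩ ⟨_, h2, h3⟩
    dsimp only at h2 h3
    refine ⟨?_, abs_le.1 h2⟩
    dsimp only
    rw [Set.mem_Icc, ← abs_le]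
    by_contra h
    push Not at h
    have h1 : |t| ^ 2 ≤ Q + |b| * |t| := by
      have : |t ^ 2| ≤ |t ^ 2 + b * t| + |b * t| := by
        have := abs_sub (t ^ 2 + b * t) (b * t); simpa using this
      rw [abs_pow, abs_mul] at this
      linarith
    have := abs_nonneg b
    nlinarith
  have hF : Integrable (Function.uncurry F) (volume.prod volume) := by
    have : Function.uncurry F = W.indicator (fun x => |2 * x.1 + x.2|) := rfl
    rw [this, integrable_indicator_iff mW]
    exact (ContinuousOn.integrableOn_compact (isCompact_Icc.prod isCompact_Icc)
      (by fun_prop)).mono_set hW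
  have e1 : (fun t => I.indicator (fun t => Q ^ 2 * omegaFn 2 Q⁻¹ t) t) = fun t => ∫ b, F t b := by
    funext t
    by_cases h : t ∈ I
    · rw [Set.indicator_of_mem h, omega_eq_s1 hQ]
      congr 1; funext b
      simp [F, W, Set.indicator, h]
    · rw [Set.indicator_of_notMem h]
      simp [F, W, Set.indicator, h]
  have e2 : (fun b => ∫ t, F t b) =
      (Set.Icc (-Q) Q).indicator (fun b => vA Q I b + vA Q (ng I) (-b)) := by
    funext b
    by_cases h : b ∈ Set.Icc (-Q) Q
    · rw [Set.indicator_of_mem h, ← inner_eq hQ hI]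
      congr 1; funext t
      have hiff : (t, b) ∈ W ↔ t ∈ {t : ℝ | t ∈ I ∧ |t ^ 2 + b * t| ≤ Q} :=
        ⟨fun h' => ⟨h'.1, h'.2.2⟩, fun h' => ⟨h'.1, abs_le.2 h, h'.2⟩⟩
      by_cases hw : (t, b) ∈ W
      · rw [Set.indicator_of_mem (hiff.1 hw)]; exact Set.indicator_of_mem hw _
      · rw [Set.indicator_of_notMem (fun h' => hw (hiff.2 h'))]; exact Set.indicator_of_notMem hw _
    · rw [Set.indicator_of_notMem h]
      rw [Set.mem_Icc, ← abs_le] at h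
      simp [F, W, Set.indicator, h]
  have i1 := (vA_full hQ hI).2
  have i2 := (vA_full hQ (ordconn_neg hI)).2
  have i3 : IntervalIntegrable (fun b => vA Q (ng I) (-b)) volume (-Q) Q := by
    rw [IntervalIntegrable.iff_comp_neg]
    simpa using i2.symm
  rw [e1, integral_integral_swap hF, e2, integral_indicator measurableSet_Icc,
    integral_Icc_eq_integral_Ioc, ← intervalIntegral.integral_of_le (by linarith),
    intervalIntegral.integral_add i1 i3]
  congr 1
  rw [intervalIntegral.integral_comp_neg (fun b => vA Q (ng I) b), neg_neg]

def RR (Q : ℝ) (I : Set ℝ) : Set (ℤ × ℤ) :=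
  {x | (x.1 : ℝ) ∈ I ∧ x.1 ≠ x.2 ∧ |((x.1 + x.2 : ℤ) : ℝ)| ≤ Q ∧ |((x.1 * x.2 : ℤ) : ℝ)| ≤ Q}

def SS (Q : ℝ) (I : Set ℝ) : Set (ℤ × ℤ) := {x | |(x.1 : ℝ)| ≤ Q ∧ (x.2 : ℝ) ∈ AA Q I x.1}

def SN (Q : ℝ) (I : Set ℝ) : Set (ℤ × ℤ) := {x | |(x.1 : ℝ)| ≤ Q ∧ (x.2 : ℝ) ∈ AA Q (ng I) (-x.1)}

def TT (Q : ℝ) (I : Set ℝ) : Set (ℤ × ℝ) := {x | |(x.1 : ℝ)| ≤ Q ∧ x.2 ∈ I ∧ 2 * x.2 + x.1 ≠ 0 ∧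
  ∃ c : ℤ, |(c : ℝ)| ≤ Q ∧ x.2 ^ 2 + x.1 * x.2 + c = 0}

lemma box_fin (Q : ℝ) : {x : ℤ × ℤ | |(x.1 : ℝ)| ≤ Q ∧ |(x.2 : ℝ)| ≤ Q}.Finite := by
  apply ((Set.finite_Icc (-⌈Q⌉) ⌈Q⌉).prod (Set.finite_Icc (-⌈Q⌉) ⌈Q⌉)).subset
  rintro ⟨a, b⟩ ⟨h1, h2⟩
  have hc := Int.le_ceil Q
  have h1 := abs_le.1 h1
  have h2 := abs_le.1 h2
  dsimp only at h1 h2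
  refine ⟨⟨?_, ?_⟩, ⟨?_, ?_⟩⟩ <;> dsimp only <;> rw [← Int.cast_le (R := ℝ)] <;> push_cast <;> linarith

lemma SS_fin (Q : ℝ) (I : Set ℝ) : (SS Q I).Finite := (box_fin Q).subset fun _ h => ⟨h.1, h.2.1⟩
lemma SN_fin (Q : ℝ) (I : Set ℝ) : (SN Q I).Finite := (box_fin Q).subset fun _ h => ⟨h.1, h.2.1⟩

lemma TT_split (Q : ℝ) (I : Set ℝ) : TT Q I =
    (fun x : ℤ × ℤ => (x.1, rt x.1 x.2)) '' SS Q I ∪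
    (fun x : ℤ × ℤ => (x.1, -rt (-x.1) x.2)) '' SN Q I := by
  ext ⟨b, t⟩
  constructor
  · rintro ⟨h1, h2, h3, c, h4, h5⟩
    dsimp only at h1 h2 h3 h4 h5
    have hd : 0 < (b:ℝ) ^ 2 - 4 * c := by
      have : 0 < (2 * t + b) ^ 2 := by positivity
      nlinarith
    rcases lt_or_gt_of_ne h3 with h | h
    · right
      have e : rt (-b) c = -t := rt_unique (by linarith) (by linarith)
      refine ⟨(b, c), ⟨h1, h4, by simpa using hd, ?_⟩, ?_⟩
      · simp only [e, ng]; simpa using h2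
      · simp only [e, neg_neg]
    · left
      have e : rt b c = t := rt_unique (by linarith) (by linarith)
      refine ⟨(b, c), ⟨h1, h4, hd, ?_⟩, ?_⟩
      · simp only [e]; exact h2
      · simp only [e]
  · rintro (⟨⟨b', c⟩, ⟨h1, h2, h3, h4⟩, h⟩ | ⟨⟨b', c⟩, ⟨h1, h2, h3, h4⟩, h⟩)
    · obtain ⟨rfl, rfl⟩ := Prod.mk.inj h
      refine ⟨h1, h4, (rt_pos h3).ne', c, h2, rt_eq h3⟩
    · obtain ⟨rfl, rfl⟩ := Prod.mk.inj h
      refine ⟨h1, h4, ?_, c, h2, ?_⟩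
      · have := rt_pos h3
        dsimp only at this ⊢; intro h; linarith
      · have := rt_eq h3
        dsimp only at this ⊢; linarith

lemma TT_fin (Q : ℝ) (I : Set ℝ) : (TT Q I).Finite := by
  rw [TT_split]; exact ((SS_fin Q I).image _).union ((SN_fin Q I).image _)

lemma TT_card (Q : ℝ) (I : Set ℝ) : (TT Q I).ncard = (SS Q I).ncard + (SN Q I).ncard := by
  rw [TT_split, Set.ncard_union_eq _ ((SS_fin Q I).image _) ((SN_fin Q I).image _),
    Set.InjOn.ncard_image, Set.InjOn.ncard_image]
  · rintro ⟨b, c⟩ h ⟨b', c'⟩ h' e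
    obtain ⟨rfl, e2⟩ := Prod.mk.inj e
    have h1 := rt_eq h.2.2.1
    have h2 := rt_eq h'.2.2.1
    dsimp only at e2 h1 h2
    rw [neg_inj] at e2
    rw [e2] at h1
    have : (c:ℝ) = c' := by linarith
    rw [Int.cast_inj] at this
    rw [this]
  · rintro ⟨b, c⟩ h ⟨b', c'⟩ h' e
    obtain ⟨rfl, e2⟩ := Prod.mk.inj e
    have h1 := rt_eq h.2.2.1
    have h2 := rt_eq h'.2.2.1
    dsimp only at e2 h1 h2
    rw [e2] at h1
    have : (c:ℝ) = c' := by linarith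
    rw [Int.cast_inj] at this
    rw [this]
  · rw [Set.disjoint_left]
    rintro ⟨b, t⟩ ⟨⟨b1, c1⟩, h1, e1⟩ ⟨⟨b2, c2⟩, h2, e2⟩
    obtain ⟨rfl, rfl⟩ := Prod.mk.inj e1
    obtain ⟨rfl, e⟩ := Prod.mk.inj e2
    have := rt_pos h1.2.2.1
    have := rt_pos h2.2.2.1
    dsimp only at *
    linarith

open Polynomial in
lemma omega_set (Q : ℝ) (hQ : 2 ≤ Q) (I : Set ℝ) :
    {α : ℝ | α ∈ I ∧ ∃ p : Polynomial ℤ, IsMinIntPoly α p ∧ p.Monic ∧ p.natDegree = 2 ∧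
      ∀ i, (|p.coeff i| : ℝ) ≤ Q} = Prod.snd '' (TT Q I ∩ {x | Irrational x.2}) := by
  ext α
  constructor
  · rintro ⟨hI, p, ⟨p0, pa, _, _, pm⟩, mon, deg, hc⟩
    have e : α ^ 2 + (p.coeff 1 : ℝ) * α + (p.coeff 0 : ℝ) = 0 := by
      rw [Polynomial.aeval_eq_sum_range, deg] at pa
      simp only [Finset.sum_range_succ, Finset.sum_range_zero] at pa
      have l : p.coeff 2 = 1 := by rw [← deg]; exact mon
      rw [l] at pa
      simp at pa
      linarith
    have irr : Irrational α := by
      rintro ⟨r, rfl⟩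
      have := pm (C (r.den : ℤ) * X + C (-r.num)) ?_ ?_
      · rw [deg, Polynomial.natDegree_linear (by exact_mod_cast r.den_nz)] at this
        omega
      · intro h
        have := congrArg (fun q => q.coeff 1) h
        simp only [coeff_add, coeff_C_mul, coeff_X_one, coeff_C, coeff_zero] at this
        simp at this
      · simp
        have : (r:ℝ) = r.num / r.den := by exact_mod_cast (Rat.num_div_den r).symm
        rw [this]
        have : (r.den:ℝ) ≠ 0 := by exact_mod_cast r.den_nz
        field_simp; ring
    refine ⟨(p.coeff 1, α), ⟨⟨hc 1, hI, ?_, p.coeff 0, hc 0, e⟩, irr⟩, rfl⟩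
    intro h
    dsimp only at h
    apply irr
    refine ⟨-(p.coeff 1 : ℚ) / 2, ?_⟩
    push_cast; linarith
  · rintro ⟨⟨b, t⟩, ⟨⟨h1, h2, h3, c, h4, h5⟩, irr⟩, rfl⟩
    dsimp only at *
    have irr : Irrational t := irr
    let p : ℤ[X] := C 1 * X ^ 2 + C b * X + C c
    have hd : p.natDegree = 2 := Polynomial.natDegree_quadratic one_ne_zero
    have mon : p.Monic := Polynomial.leadingCoeff_quadratic one_ne_zero
    refine ⟨h2, p, ⟨mon.ne_zero, ?_, ?_, mon.isPrimitive.content_eq_one, ?_⟩, mon, hd, ?_⟩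
    · simp [p]; linarith
    · rw [mon.leadingCoeff]; norm_num
    · intro q q0 qa
      rw [hd]
      by_contra hlt
      push Not at hlt
      rw [Polynomial.eq_X_add_C_of_natDegree_le_one (show q.natDegree ≤ 1 by omega)] at qa
      simp at qa
      by_cases hq : q.coeff 1 = 0
      · rw [hq] at qa
        simp at qa
        apply q0
        rw [Polynomial.eq_X_add_C_of_natDegree_le_one (show q.natDegree ≤ 1 by omega), hq, qa]
        simp
      · apply irr
        refine ⟨-(q.coeff 0 : ℚ) / q.coeff 1, ?_⟩
        have : (q.coeff 1 : ℝ) ≠ 0 := by exact_mod_cast hq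
        push_cast
        field_simp; linarith
    · intro i
      have : p.coeff i = if i = 0 then c else if i = 1 then b else if i = 2 then 1 else 0 := by
        simp only [p, coeff_add, coeff_C_mul, coeff_X_pow, coeff_X, coeff_C]
        rcases i with _ | _ | _ | i <;> simp
      rw [this]
      split_ifs
      · exact h4
      · exact h1
      · simp; linarith
      · simp; linarith

lemma rat_set (Q : ℝ) (I : Set ℝ) :
    TT Q I ∩ {x | ¬ Irrational x.2} = (fun x : ℤ × ℤ => (-(x.1 + x.2), (x.1 : ℝ))) '' RR Q I := by
  ext ⟨b, t⟩
  constructor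
  · rintro ⟨⟨h1, h2, h3, c, h4, h5⟩, irr⟩
    have irr : ¬ Irrational t := irr
    dsimp only at h1 h2 h3 h4 h5
    unfold Irrational at irr
    push Not at irr
    obtain ⟨r, rfl⟩ := irr
    have hr : r ^ 2 + b * r + c = 0 := by exact_mod_cast h5
    have hint : IsIntegral ℤ r := by
      refine ⟨Polynomial.C 1 * Polynomial.X ^ 2 + Polynomial.C b * Polynomial.X + Polynomial.C c,
        Polynomial.leadingCoeff_quadratic one_ne_zero, ?_⟩
      simp only [Polynomial.eval₂_add, Polynomial.eval₂_mul, Polynomial.eval₂_C,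
        Polynomial.eval₂_X, Polynomial.eval₂_X_pow, map_one, one_mul]
      simp only [eq_intCast]
      linarith
    obtain ⟨a, rfl⟩ := IsIntegrallyClosed.isIntegral_iff.1 hint
    simp only [eq_intCast, Rat.cast_intCast] at *
    have hc : a * (-b - a) = c := by
      have : (a:ℚ) * (-b - a) = c := by linarith
      exact_mod_cast this
    refine ⟨(a, -b - a), ⟨h2, ?_, ?_, ?_⟩, ?_⟩
    · intro h
      dsimp only at h
      apply h3
      have : 2 * a + b = 0 := by omega
      exact_mod_cast this
    · dsimp only
      rw [show a + (-b - a) = -b by ring]; push_cast; rwa [abs_neg]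
    · dsimp only; rw [hc]; exact h4
    · simp
  · rintro ⟨⟨a, d⟩, ⟨h1, h2, h3, h4⟩, h⟩
    obtain ⟨rfl, rfl⟩ := Prod.mk.inj h
    refine ⟨⟨?_, h1, ?_, a * d, h4, ?_⟩, ?_⟩
    · dsimp only; push_cast; push_cast at h3; rwa [abs_neg]
    · dsimp only at *
      intro h
      apply h2
      have : (a:ℝ) = d := by push_cast at h; linarith
      exact_mod_cast this
    · push_cast; ring
    · exact fun h => h ⟨(a:ℚ), by simp⟩

lemma count_eq (Q : ℝ) (hQ : 2 ≤ Q) (I : Set ℝ) :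
    OmegaCount 2 Q I + (RR Q I).ncard = (SS Q I).ncard + (SN Q I).ncard := by
  have h1 : OmegaCount 2 Q I = (TT Q I ∩ {x | Irrational x.2}).ncard := by
    unfold OmegaCount
    rw [omega_set Q hQ I, Set.InjOn.ncard_image]
    rintro ⟨b, t⟩ ⟨⟨_, _, _, c, _, h⟩, irr⟩ ⟨b', t'⟩ ⟨⟨_, _, _, c', _, h'⟩, _⟩ e
    dsimp only at *
    subst e
    by_contra hne
    have hb : b ≠ b' := fun hb => hne (by rw [hb])
    have hb' : (b:ℝ) - b' ≠ 0 := by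
      rw [sub_ne_zero]; exact_mod_cast hb
    have irr : Irrational t := irr
    apply irr
    refine ⟨((c':ℚ) - c) / (b - b'), ?_⟩
    push_cast
    rw [div_eq_iff hb']; linarith
  have h2 : (RR Q I).ncard = (TT Q I ∩ {x | ¬ Irrational x.2}).ncard := by
    rw [rat_set, Set.InjOn.ncard_image]
    rintro ⟨a, d⟩ _ ⟨a', d'⟩ _ e
    obtain ⟨e1, e2⟩ := Prod.mk.inj e
    dsimp only at e1 e2
    have e2 : a = a' := by exact_mod_cast e2
    have : d = d' := by omega
    rw [e2, this]
  rw [h1, h2, ← TT_card]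
  have := Set.ncard_inter_add_ncard_sdiff_eq_ncard (TT Q I) {x | Irrational x.2} (TT_fin Q I)
  rw [← this]
  congr 2

lemma mem_box {Q : ℝ} (hQ : 2 ≤ Q) (k : ℤ) :
    |(k:ℝ)| ≤ Q ↔ k ∈ Finset.Icc (-(⌊Q⌋₊:ℤ)) ⌊Q⌋₊ := by
  have e : (⌊Q⌋₊ : ℤ) = ⌊Q⌋ := Int.natCast_floor_eq_floor (by linarith)
  rw [e, Finset.mem_Icc, abs_le]
  constructor
  · rintro ⟨h1, h2⟩
    have a := Int.le_floor.2 h2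
    have b : -k ≤ ⌊Q⌋ := Int.le_floor.2 (by push_cast; linarith)
    omega
  · rintro ⟨h1, h2⟩
    have a := Int.le_floor.1 h2
    have b : ((-k : ℤ) : ℝ) ≤ Q := Int.le_floor.1 (by omega)
    push_cast at b
    constructor <;> linarith

lemma ncard_double {Q : ℝ} (S : Set (ℤ × ℤ)) (P : ℤ → Set ℝ)
    (h : ∀ b c : ℤ, (b, c) ∈ S ↔ b ∈ Finset.Icc (-(⌊Q⌋₊:ℤ)) ⌊Q⌋₊ ∧
      c ∈ Finset.Icc (-(⌊Q⌋₊:ℤ)) ⌊Q⌋₊ ∧ (c:ℝ) ∈ P b) :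
    (S.ncard : ℝ) = ∑ b ∈ Finset.Icc (-(⌊Q⌋₊:ℤ)) ⌊Q⌋₊, ∑ k ∈ Finset.Icc (-(⌊Q⌋₊:ℤ)) ⌊Q⌋₊,
      (P b).indicator (fun _ => (1:ℝ)) (k:ℝ) := by
  classical
  have : S = ↑((Finset.Icc (-(⌊Q⌋₊:ℤ)) ⌊Q⌋₊ ×ˢ Finset.Icc (-(⌊Q⌋₊:ℤ)) ⌊Q⌋₊).filter
      (fun x => (x.2:ℝ) ∈ P x.1)) := by
    ext ⟨b, c⟩
    rw [h, Finset.mem_coe, Finset.mem_filter, Finset.mem_product, and_assoc]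
  rw [this, Set.ncard_coe_finset, Finset.card_filter, Finset.sum_product]
  push_cast
  refine Finset.sum_congr rfl fun b _ => Finset.sum_congr rfl fun k _ => ?_
  simp only [Set.indicator]

lemma SS_near {Q : ℝ} (hQ : 2 ≤ Q) {I : Set ℝ} (hI : I.OrdConnected) :
    |((SS Q I).ncard : ℝ) - ∫ x in (-Q)..Q, vA Q I x| ≤ 50 * Q := by
  rw [ncard_double (Q := Q) (SS Q I) (fun b => AA Q I b)]
  · exact cA_total hQ hI
  · intro b c
    rw [← mem_box hQ, ← mem_box hQ]
    exact ⟨fun h => ⟨h.1, h.2.1, h.2⟩, fun h => ⟨h.1, h.2.2⟩⟩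

lemma SN_near {Q : ℝ} (hQ : 2 ≤ Q) {I : Set ℝ} (hI : I.OrdConnected) :
    |((SN Q I).ncard : ℝ) - ∫ x in (-Q)..Q, vA Q (ng I) x| ≤ 50 * Q := by
  have : (SN Q I).ncard = (SS Q (ng I)).ncard := by
    have e : SN Q I = (fun x : ℤ × ℤ => (-x.1, x.2)) '' SS Q (ng I) := by
      ext ⟨b, c⟩
      constructor
      · rintro ⟨h1, h2⟩
        refine ⟨(-b, c), ⟨?_, ?_⟩, by simp⟩
        · dsimp only; push_cast; rwa [abs_neg]
        · dsimp only; push_cast; exact h2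
      · rintro ⟨⟨b', c'⟩, ⟨h1, h2⟩, e⟩
        obtain ⟨rfl, rfl⟩ := Prod.mk.inj e
        refine ⟨?_, ?_⟩
        · dsimp only at *; push_cast; rwa [abs_neg]
        · dsimp only at *; push_cast; rwa [neg_neg]
    rw [e, Set.InjOn.ncard_image]
    rintro ⟨b, c⟩ _ ⟨b', c'⟩ _ e
    obtain ⟨e1, rfl⟩ := Prod.mk.inj e
    have e2 : b = b' := neg_inj.1 e1
    rw [e2]
  rw [this]
  exact SS_near hQ (ordconn_neg hI)

/-- number of admissible partners -/
noncomputable def rr (N : ℕ) (a : ℤ) : ℕ :=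
  ((Finset.Icc (-(N:ℤ)) N).filter (fun d => a ≠ d ∧ |a + d| ≤ N ∧ |a * d| ≤ N)).card

lemma RR_card {Q : ℝ} (hQ : 2 ≤ Q) (I : Set ℝ) : ((RR Q I).ncard : ℝ) =
    ∑ a ∈ Finset.Icc (-(⌊Q⌋₊:ℤ)) ⌊Q⌋₊, I.indicator (fun _ => (rr ⌊Q⌋₊ a : ℝ)) (a:ℝ) := by
  classical
  have key : ∀ k : ℤ, |(k:ℝ)| ≤ Q ↔ |k| ≤ (⌊Q⌋₊:ℤ) := by
    intro k; rw [mem_box hQ, Finset.mem_Icc, abs_le]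
  have : RR Q I = ↑((Finset.Icc (-(⌊Q⌋₊:ℤ)) ⌊Q⌋₊ ×ˢ Finset.Icc (-(⌊Q⌋₊:ℤ)) ⌊Q⌋₊).filter
      (fun x => (x.1:ℝ) ∈ I ∧ (x.1 ≠ x.2 ∧ |x.1 + x.2| ≤ (⌊Q⌋₊:ℤ) ∧ |x.1 * x.2| ≤ (⌊Q⌋₊:ℤ)))) := by
    ext ⟨a, d⟩
    rw [Finset.mem_coe, Finset.mem_filter, Finset.mem_product]
    simp only [Finset.mem_Icc, ← abs_le]
    constructor
    · rintro ⟨h1, h2, h3, h4⟩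
      rw [key] at h3 h4
      refine ⟨?_, h1, h2, h3, h4⟩
      dsimp only at *
      rcases eq_or_ne a 0 with rfl | ha
      · simp at h3 ⊢; exact h3
      · rcases eq_or_ne d 0 with rfl | hd
        · simp at h3 ⊢; exact h3
        · rw [abs_mul] at h4
          have := Int.one_le_abs ha
          have := Int.one_le_abs hd
          constructor <;> nlinarith
    · rintro ⟨_, h1, h2, h3, h4⟩
      exact ⟨h1, h2, (key _).2 h3, (key _).2 h4⟩
  rw [this, Set.ncard_coe_finset, Finset.card_filter, Finset.sum_product]
  push_cast
  refine Finset.sum_congr rfl fun a _ => ?_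
  by_cases h : (a:ℝ) ∈ I
  · rw [Set.indicator_of_mem h]
    simp only [h, true_and, rr]
    rw [Finset.card_filter]; push_cast; rfl
  · rw [Set.indicator_of_notMem h]
    simp [h]

lemma rr_near {Q : ℝ} (hQ : 2 ≤ Q) (a : ℤ) (ha : 2 ≤ |a|) (haN : |a| ≤ ⌊Q⌋₊) :
    |(rr ⌊Q⌋₊ a : ℝ) - 2 * Q * (1 / max 1 |(a:ℝ)|)| ≤ 4 := by
  have hN1 := Nat.floor_le (show 0 ≤ Q by linarith)
  have hN2 := Nat.lt_floor_add_one Q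
  set N := ⌊Q⌋₊
  set m : ℤ := (N:ℤ) / |a| with hm
  have hm0 : 0 ≤ m := by positivity
  have m1 : m * |a| ≤ N := Int.ediv_mul_le _ (by omega)
  have m2 : (N:ℤ) < (m + 1) * |a| := Int.lt_ediv_add_one_mul_self _ (by omega)
  have up : rr N a ≤ (Finset.Icc (-m) m).card := by
    apply Finset.card_le_card
    intro d hd
    rw [Finset.mem_filter] at hd
    rw [Finset.mem_Icc, ← abs_le]
    have := hd.2.2.2
    rw [abs_mul] at this
    rw [hm, Int.le_ediv_iff_mul_le (by omega)]
    linarith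
  have lo : (Finset.Icc (-m) m).card ≤ rr N a + 3 := by
    have : Finset.Icc (-m) m ⊆ ((Finset.Icc (-(N:ℤ)) N).filter
        (fun d => a ≠ d ∧ |a + d| ≤ N ∧ |a * d| ≤ N)) ∪ {a, 1, -1} := by
      intro d hd
      rw [Finset.mem_Icc, ← abs_le] at hd
      have had : |a| * |d| ≤ N := by nlinarith
      simp only [Finset.mem_union, Finset.mem_filter, Finset.mem_insert, Finset.mem_singleton,
        Finset.mem_Icc]
      by_cases h1 : d = a
      · tauto
      by_cases h2 : d = 1
      · tauto
      by_cases h3 : d = -1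
      · tauto
      left
      rw [← abs_le]
      refine ⟨?_, fun h => h1 h.symm, ?_, by rwa [abs_mul]⟩
      · have := abs_nonneg d; nlinarith
      · rcases eq_or_ne d 0 with rfl | h0
        · simpa using haN
        · have : 2 ≤ |d| := by
            rw [le_abs]; omega
          have := abs_add_le a d
          nlinarith
    refine (Finset.card_le_card this).trans ((Finset.card_union_le _ _).trans ?_)
    exact Nat.add_le_add_left Finset.card_le_three _
  have cc : ((Finset.Icc (-m) m).card : ℝ) = 2 * (m:ℝ) + 1 := by
    rw [Int.card_Icc]
    have : ((m + 1 - -m).toNat : ℤ) = 2 * m + 1 := by omega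
    exact_mod_cast this
  have up' : (rr N a : ℝ) ≤ 2 * (m:ℝ) + 1 := by rw [← cc]; exact_mod_cast up
  have lo' : 2 * (m:ℝ) + 1 ≤ (rr N a : ℝ) + 3 := by rw [← cc]; exact_mod_cast lo
  have ha2 : (2:ℝ) ≤ |(a:ℝ)| := by exact_mod_cast ha
  have m1' : (m:ℝ) * |(a:ℝ)| ≤ N := by exact_mod_cast m1
  have m2' : (N:ℝ) + 1 ≤ (m + 1) * |(a:ℝ)| := by exact_mod_cast m2
  rw [max_eq_right (by linarith)]
  have q1 : (m:ℝ) ≤ Q / |(a:ℝ)| := by rw [le_div_iff₀ (by linarith)]; linarith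
  have q2 : Q / |(a:ℝ)| ≤ m + 1 := by rw [div_le_iff₀ (by linarith)]; linarith
  rw [show 2 * Q * (1 / |(a:ℝ)|) = 2 * (Q / |(a:ℝ)|) by ring, abs_le]
  constructor <;> linarith

lemma rr_near' {Q : ℝ} (hQ : 2 ≤ Q) (a : ℤ) (haN : |a| ≤ ⌊Q⌋₊) :
    |(rr ⌊Q⌋₊ a : ℝ) - 2 * Q * (1 / max 1 |(a:ℝ)|)| ≤
      4 + (if a = 0 then 3 * Q else 0) + (if a = 1 then 3 * Q else 0) +
        (if a = -1 then 3 * Q else 0) := by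
  by_cases h : 2 ≤ |a|
  · refine (rr_near hQ a h haN).trans ?_
    have : ∀ p : Prop, ∀ [Decidable p], 0 ≤ (if p then 3 * Q else 0) := by
      intro p _; split_ifs <;> linarith
    have h1 := this (a = 0)
    have h2 := this (a = 1)
    have h3 := this (a = -1)
    linarith
  · have h' : a = 0 ∨ a = 1 ∨ a = -1 := by
      rw [le_abs] at h; omega
    have hmax : max 1 |(a:ℝ)| = 1 := by
      rcases h' with rfl | rfl | rfl <;> simp
    have e : 3 * Q ≤ (if a = 0 then 3 * Q else 0) + (if a = 1 then 3 * Q else 0) +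
        (if a = -1 then 3 * Q else 0) := by
      rcases h' with rfl | rfl | rfl <;> norm_num
    rw [hmax]
    have u : rr ⌊Q⌋₊ a ≤ 2 * ⌊Q⌋₊ + 1 := by
      refine (Finset.card_filter_le _ _).trans ?_
      rw [Int.card_Icc]; omega
    have u' : (rr ⌊Q⌋₊ a : ℝ) ≤ 2 * ⌊Q⌋₊ + 1 := by exact_mod_cast u
    have := Nat.floor_le (show 0 ≤ Q by linarith)
    have : (0:ℝ) ≤ rr ⌊Q⌋₊ a := Nat.cast_nonneg _
    rw [abs_le]; constructor <;> linarith

lemma phi_sum {Q : ℝ} (hQ : 2 ≤ Q) {I : Set ℝ} (hI : I.OrdConnected) :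
    |∑ a ∈ Finset.Icc (-(⌊Q⌋₊:ℤ)) ⌊Q⌋₊, I.indicator (fun x : ℝ => 1 / max 1 |x|) (a:ℝ) -
      ∫ t in I ∩ Set.Icc (-Q) Q, (1 / max 1 |t|)| ≤ 5 := by
  have := ordconn_full hQ hI (φ := fun x : ℝ => 1 / max 1 |x|) ?_ (by simp) ?_ ?_
  · rw [intervalIntegral.integral_of_le (by linarith), ← integral_Icc_eq_integral_Ioc,
      setIntegral_indicator hI.measurableSet, Set.inter_comm] at this
    exact this
  · intro x hx y hy hxy
    dsimp only
    rw [abs_of_nonneg hx.1, abs_of_nonneg hy.1]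
    gcongr
  · intro x _; positivity
  · intro x _
    rw [div_le_one (by positivity)]; exact le_max_left _ _

lemma RR_near {Q : ℝ} (hQ : 2 ≤ Q) {I : Set ℝ} (hI : I.OrdConnected) :
    |((RR Q I).ncard : ℝ) - 2 * Q * ∫ t in I ∩ Set.Icc (-Q) Q, (1 / max 1 |t|)| ≤ 50 * Q := by
  have h1 := phi_sum hQ hI
  have h2 : |∑ a ∈ Finset.Icc (-(⌊Q⌋₊:ℤ)) ⌊Q⌋₊, (I.indicator (fun _ => (rr ⌊Q⌋₊ a : ℝ)) (a:ℝ) -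
      2 * Q * I.indicator (fun x : ℝ => 1 / max 1 |x|) (a:ℝ))| ≤
      ∑ a ∈ Finset.Icc (-(⌊Q⌋₊:ℤ)) ⌊Q⌋₊, (4 + (if a = 0 then 3 * Q else 0) +
        (if a = 1 then 3 * Q else 0) + (if a = -1 then 3 * Q else 0)) := by
    refine (Finset.abs_sum_le_sum_abs _ _).trans (Finset.sum_le_sum fun a ha => ?_)
    have := rr_near' hQ a (abs_le.2 (Finset.mem_Icc.1 ha))
    by_cases h : (a:ℝ) ∈ I
    · rw [Set.indicator_of_mem h, Set.indicator_of_mem h]; exact this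
    · rw [Set.indicator_of_notMem h, Set.indicator_of_notMem h]
      refine le_trans ?_ ((abs_nonneg _).trans this)
      simp
  rw [Finset.sum_sub_distrib, ← RR_card hQ, ← Finset.mul_sum, Finset.sum_add_distrib,
    Finset.sum_add_distrib, Finset.sum_add_distrib, Finset.sum_const, Int.card_Icc,
    nsmul_eq_mul, Finset.sum_ite_eq', Finset.sum_ite_eq', Finset.sum_ite_eq'] at h2
  have e : (((⌊Q⌋₊:ℤ) + 1 - -(⌊Q⌋₊:ℤ)).toNat : ℝ) = 2 * (⌊Q⌋₊:ℝ) + 1 := by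
    rw [show ((⌊Q⌋₊:ℤ) + 1 - -(⌊Q⌋₊:ℤ)).toNat = 2 * ⌊Q⌋₊ + 1 by omega]; push_cast; ring
  rw [e] at h2
  have hN := Nat.floor_le (show 0 ≤ Q by linarith)
  have i : ∀ p : Prop, ∀ [Decidable p], (if p then 3 * Q else 0) ≤ 3 * Q := by
    intro p _; split_ifs <;> linarith
  have h3 := h2.trans (add_le_add (add_le_add (add_le_add le_rfl (i _)) (i _)) (i _))
  have h1 := abs_le.1 h1
  have h3 := abs_le.1 h3
  rw [abs_le]; constructor <;> nlinarith

theorem quadratic_count_asymptotic :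
    ∃ C : ℝ, 0 < C ∧ ∀ I : Set ℝ, I.OrdConnected → ∀ Q : ℝ, 2 ≤ Q →
      abs ((OmegaCount 2 Q I : ℝ) - Q ^ 2 * (∫ t in I, omegaFn 2 Q⁻¹ t)
        + 2 * Q * ∫ t in I ∩ Set.Icc (-Q) Q, 1 / max 1 |t|) ≤ C * Q := by
  refine ⟨150, by norm_num, fun I hI Q hQ => ?_⟩
  have h1 := abs_le.1 (SS_near hQ hI)
  have h2 := abs_le.1 (SN_near hQ hI)
  have h3 := abs_le.1 (RR_near hQ hI)
  have h4 : (OmegaCount 2 Q I : ℝ) + (RR Q I).ncard = (SS Q I).ncard + (SN Q I).ncard := by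
    exact_mod_cast count_eq Q hQ I
  rw [area_eq hQ hI, abs_le]
  constructor <;> linarith
end

section
/- Fix an integer n ≥ 2. For every t ∈ ℝ, ω_n(ξ,t) tends to φ_{n−1}(t) as ξ → 0⁺. -/
open MeasureTheory Filter

/-- The domain `G_n(t) ⊆ ℝ^n`: vectors `(p_1, …, p_n)` (indexed by `i : Fin n`, where `p i`
stands for `p_{i+1}`) with `|p_i| ≤ 1` and `|∑_{k=1}^{n} p_k t^k| ≤ 1`. -/
def Gset (n : ℕ) (t : ℝ) : Set (Fin n → ℝ) :=
  {p | (∀ i, |p i| ≤ 1) ∧ |∑ i, p i * t ^ ((i : ℕ) + 1)| ≤ 1}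

/-- The density function `φ_n(t)` of real algebraic numbers of degree `n`. -/
noncomputable def phiFn (n : ℕ) (t : ℝ) : ℝ :=
  ∫ p in Gset n t, |∑ i : Fin n, ((i : ℕ) + 1 : ℝ) * p i * t ^ (i : ℕ)|

lemma null_level (m : ℕ) (t c : ℝ) (hc : c ≠ 0) :
    volume {p : Fin m → ℝ | ∑ i, p i * t ^ ((i : ℕ) + 1) = c} = 0 := by
  let s : AffineSubspace ℝ (Fin m → ℝ) :=
    { carrier := {p : Fin m → ℝ | ∑ i, p i * t ^ ((i : ℕ) + 1) = c}
      smul_vsub_vadd_mem' := by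
        intro a p q r hp hq hr
        simp only [Set.mem_ofPred_eq] at hp hq hr ⊢
        have : ∀ i, (a • (p -ᵥ q) +ᵥ r) i * t ^ ((i : ℕ) + 1)
            = a * (p i * t ^ ((i : ℕ) + 1)) - a * (q i * t ^ ((i : ℕ) + 1))
              + r i * t ^ ((i : ℕ) + 1) := by
          intro i
          simp
          ring
        simp only [this, Finset.sum_add_distrib, Finset.sum_sub_distrib, ← Finset.mul_sum,
          hp, hq, hr]
        ring }
  have hs : s ≠ ⊤ := by
    intro h
    have h0 : (0 : Fin m → ℝ) ∈ s := by rw [h]; trivial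
    have h1 : ∑ i, (0 : Fin m → ℝ) i * t ^ ((i : ℕ) + 1) = c := h0
    simp at h1
    exact hc h1.symm
  exact Measure.addHaar_affineSubspace volume s hs

lemma meas_Dset (n : ℕ) (ξ t : ℝ) : MeasurableSet (Dset n ξ t) := by
  apply IsClosed.measurableSet
  have h1 : IsClosed {p : Fin (n - 1) → ℝ | ∀ i, |p i| ≤ 1} := by
    simp only [Set.ofPred_forall]
    exact isClosed_iInter fun i => isClosed_le (by fun_prop) (by fun_prop)
  have h2 : IsClosed {p : Fin (n - 1) → ℝ |
      |ξ * t ^ n + ∑ i, p i * t ^ ((i : ℕ) + 1)| ≤ 1} :=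
    isClosed_le (by fun_prop) (by fun_prop)
  exact h1.inter h2

lemma Gset_eq (n : ℕ) (t : ℝ) : Gset (n - 1) t = Dset n 0 t := by
  ext p; simp [Gset, Dset]

theorem omega_tendsto_phi (n : ℕ) (hn : 2 ≤ n) (t : ℝ) :
    Tendsto (fun ξ : ℝ => omegaFn n ξ t) (nhdsWithin 0 (Set.Ioi 0))
      (nhds (phiFn (n - 1) t)) := by
  unfold omegaFn phiFn
  rw [Gset_eq, ← integral_indicator (meas_Dset n 0 t)]
  simp_rw [← integral_indicator (meas_Dset n _ t)]
  have hmem : Set.Ioo (0 : ℝ) 1 ∈ nhdsWithin (0 : ℝ) (Set.Ioi 0) :=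
    Ioo_mem_nhdsGT one_pos
  refine tendsto_integral_filter_of_dominated_convergence
    ((Set.Icc (-1 : Fin (n - 1) → ℝ) 1).indicator fun _ =>
      (n : ℝ) * |t| ^ (n - 1) + ∑ i : Fin (n - 1), ((i : ℕ) + 1 : ℝ) * |t| ^ (i : ℕ)) ?_ ?_ ?_ ?_
  · refine Eventually.of_forall fun ξ => ?_
    refine AEStronglyMeasurable.indicator ?_ (meas_Dset n ξ t)
    exact Continuous.aestronglyMeasurable (by fun_prop)
  · filter_upwards [hmem] with ξ hξ
    refine Eventually.of_forall fun p => ?_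
    by_cases hp : p ∈ Dset n ξ t
    · have hp1 : ∀ i, |p i| ≤ 1 := hp.1
      have hc : p ∈ Set.Icc (-1 : Fin (n - 1) → ℝ) 1 :=
        ⟨fun i => (abs_le.1 (hp1 i)).1, fun i => (abs_le.1 (hp1 i)).2⟩
      rw [Set.indicator_of_mem hp, Set.indicator_of_mem hc, Real.norm_eq_abs, abs_abs]
      refine (abs_add_le _ _).trans (add_le_add ?_ ?_)
      · rw [abs_mul, abs_mul, abs_pow, Nat.abs_cast, abs_of_pos hξ.1]
        have : (n : ℝ) * ξ ≤ n := mul_le_of_le_one_right (Nat.cast_nonneg n) hξ.2.le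
        gcongr
      · refine (Finset.abs_sum_le_sum_abs _ _).trans (Finset.sum_le_sum fun i _ => ?_)
        have hi : (0 : ℝ) ≤ (i : ℕ) + 1 := by positivity
        rw [abs_mul, abs_mul, abs_pow, abs_of_nonneg hi]
        have := mul_le_of_le_one_right hi (hp1 i)
        gcongr
    · rw [Set.indicator_of_notMem hp, norm_zero]
      exact Set.indicator_nonneg (fun _ _ => by positivity) _
  · rw [integrable_indicator_iff measurableSet_Icc]
    exact integrableOn_const (isCompact_Icc.measure_lt_top.ne)
  · have h1 := measure_eq_zero_iff_ae_notMem.1 (null_level (n - 1) t 1 one_ne_zero)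
    have h2 := measure_eq_zero_iff_ae_notMem.1
      (null_level (n - 1) t (-1) (neg_ne_zero.2 one_ne_zero))
    filter_upwards [h1, h2] with p hp1 hp2
    replace hp1 : ¬ ∑ i, p i * t ^ ((i : ℕ) + 1) = 1 := hp1
    replace hp2 : ¬ ∑ i, p i * t ^ ((i : ℕ) + 1) = -1 := hp2
    have hne : |∑ i, p i * t ^ ((i : ℕ) + 1)| ≠ 1 := by
      intro h
      rcases (abs_eq zero_le_one).1 h with h | h
      · exact hp1 h
      · exact hp2 h
    have hcont : Tendsto (fun ξ : ℝ => |ξ * t ^ n + ∑ i, p i * t ^ ((i : ℕ) + 1)|)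
        (nhdsWithin 0 (Set.Ioi 0)) (nhds |∑ i, p i * t ^ ((i : ℕ) + 1)|) := by
      have : Continuous (fun ξ : ℝ => |ξ * t ^ n + ∑ i, p i * t ^ ((i : ℕ) + 1)|) := by fun_prop
      have := this.tendsto 0
      simp only [zero_mul, zero_add] at this
      exact this.mono_left nhdsWithin_le_nhds
    have hf : Tendsto (fun ξ : ℝ => |(n : ℝ) * ξ * t ^ (n - 1)
          + ∑ i : Fin (n - 1), ((i : ℕ) + 1 : ℝ) * p i * t ^ (i : ℕ)|)
        (nhdsWithin 0 (Set.Ioi 0))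
        (nhds |∑ i : Fin (n - 1), ((i : ℕ) + 1 : ℝ) * p i * t ^ (i : ℕ)|) := by
      have : Continuous (fun ξ : ℝ => |(n : ℝ) * ξ * t ^ (n - 1)
          + ∑ i : Fin (n - 1), ((i : ℕ) + 1 : ℝ) * p i * t ^ (i : ℕ)|) := by fun_prop
      have := this.tendsto 0
      simp only [zero_mul, mul_zero, zero_add] at this
      exact this.mono_left nhdsWithin_le_nhds
    by_cases hp : p ∈ Dset n 0 t
    · rw [Set.indicator_of_mem hp]
      refine hf.congr' ?_
      have hlt : |∑ i, p i * t ^ ((i : ℕ) + 1)| < 1 :=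
        lt_of_le_of_ne (by simpa using hp.2) hne
      filter_upwards [hcont.eventually (gt_mem_nhds hlt)] with ξ hξ
      rw [Set.indicator_of_mem (show p ∈ Dset n ξ t from ⟨hp.1, hξ.le⟩)]
    · rw [Set.indicator_of_notMem hp]
      refine tendsto_const_nhds.congr' ?_
      by_cases hb : ∀ i, |p i| ≤ 1
      · have hgt : 1 < |∑ i, p i * t ^ ((i : ℕ) + 1)| := by
          by_contra h
          exact hp ⟨hb, by simpa using not_lt.1 h⟩
        filter_upwards [hcont.eventually (lt_mem_nhds hgt)] with ξ hξ
        rw [Set.indicator_of_notMem]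
        exact fun h => absurd h.2 (not_le.2 hξ)
      · refine Eventually.of_forall fun ξ => ?_
        beta_reduce
        rw [Set.indicator_of_notMem]
        exact fun h => hb h.1
end
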